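/- arXiv:1602.07093 — 2 statements merged into one kernel-verified Lean document; each statement's English description precedes it below -/
import Mathlib

section
/- Let F be a field of characteristic 2, let D be a finite-dimensional central division F-algebra, and let ψ = a₁[1,b₁] ⊥ … ⊥ aₙ[1,bₙ] ⊥ ⟨1,c₁,…,c_m⟩ be an anisotropic quadratic form over F of dimension 2n+m+1 ≥ 2 with m ≥ 0. Then D ⊗_F F(ψ) is not a division algebra if and only if D contains an F-subalgebra isomorphic to [b₁,a₁) ⊗_F ⋯ ⊗_F [bₙ,aₙ) ⊗_F F(√c₁,…,√c_m), where F(√c₁,…,√c_m) is the field obtained from F by adjoining square roots of c₁,…,c_m. -/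
open QuadraticMap MvPolynomial
open scoped TensorProduct

set_option synthInstance.maxHeartbeats 1000000
set_option maxHeartbeats 1000000


section Defs

variable {K : Type} [CommRing K]

/-- The binary quadratic form `[a,b] : (x,y) ↦ a·x² + x·y + b·y²`. -/
noncomputable def binQF (a b : K) : QuadraticForm K (Fin 2 → K) :=
  (Matrix.of ![![a, 1], ![0, b]]).toQuadraticMap'

/-- The diagonal (totally singular) quadratic form `⟨c₁, …, c_s⟩`. -/
noncomputable def diagQF {s : ℕ} (c : Fin s → K) : QuadraticForm K (Fin s → K) :=
  QuadraticMap.weightedSumSquares K c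

/-- The orthogonal sum `[a₁,b₁] ⊥ ⋯ ⊥ [a_r,b_r]` of binary forms. -/
noncomputable def binsQF {r : ℕ} (a b : Fin r → K) : QuadraticForm K (Fin r → Fin 2 → K) :=
  QuadraticMap.pi fun i => binQF (a i) (b i)

/-- The orthogonal sum of `m` hyperbolic planes `[0,0]`. -/
noncomputable def hypQF (K : Type) [CommRing K] (m : ℕ) :
    QuadraticForm K (Fin m → Fin 2 → K) :=
  binsQF (fun _ => 0) (fun _ => 0)

/-- The `(n+1)`-fold quadratic Pfister form `⟨⟨a₁,…,aₙ⟩⟩_b ⊗ [1,c]`, i.e. the orthogonal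
sum over all subsets `S ⊆ {1,…,n}` of `(∏_{i∈S} aᵢ)·[1,c]`. -/
noncomputable def pfisterQF (n : ℕ) (a : Fin n → K) (c : K) :
    QuadraticForm K (Finset (Fin n) → Fin 2 → K) :=
  QuadraticMap.pi fun S : Finset (Fin n) => (∏ i ∈ S, a i) • binQF 1 c

variable {V W : Type} [AddCommGroup V] [Module K V] [AddCommGroup W] [Module K W]

/-- `φ` has type `(r,s)`: it is isometric to `[a₁,b₁] ⊥ ⋯ ⊥ [a_r,b_r] ⊥ ⟨c₁,…,c_s⟩`. -/
def HasTypeRS (φ : QuadraticForm K V) (r s : ℕ) : Prop :=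
  ∃ (a b : Fin r → K) (c : Fin s → K), φ.Equivalent ((binsQF a b).prod (diagQF c))

/-- `φ` is dominated by `ψ`. -/
def Dominated (φ : QuadraticForm K V) (ψ : QuadraticForm K W) : Prop :=
  ∃ f : V →ₗ[K] W, Function.Injective f ∧ ∀ v, φ v = ψ (f v)

/-- `φ` is weakly dominated by `ψ`: `α·φ` is dominated by `ψ` for some unit `α`. -/
def WeaklyDominated (φ : QuadraticForm K V) (ψ : QuadraticForm K W) : Prop :=
  ∃ α : Kˣ, Dominated ((α : K) • φ) ψ

/-- Witt equivalence of quadratic forms. -/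
def WittEquiv (Q₁ : QuadraticForm K V) (Q₂ : QuadraticForm K W) : Prop :=
  ∃ k l : ℕ, (Q₁.prod (hypQF K k)).Equivalent (Q₂.prod (hypQF K l))

/-- `φ` is a Pfister neighbour: there is a quadratic Pfister form `π` with
`2·dim φ > dim π` and `φ ≺_w π`. -/
def IsPfisterNeighbour (φ : QuadraticForm K V) : Prop :=
  ∃ (n : ℕ) (a : Fin n → Kˣ) (c : K),
    2 * Module.finrank K V > 2 ^ (n + 1) ∧
      WeaklyDominated φ (pfisterQF n (fun i => (a i : K)) c)

/-- The Artin–Schreier set `℘(K) = {t² + t : t ∈ K}`. -/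
def ArtinSchreier (K : Type) [CommRing K] : Set K := {x : K | ∃ t : K, x = t ^ 2 + t}

end Defs

section FunField

variable (F : Type) [Field F]

/-- The coefficient matrix of a quadratic form on `Fin n → F` with respect to the
standard basis: diagonal entries `ψ(eᵢ)`, above-diagonal entries `b_ψ(eᵢ,eⱼ)`. -/
noncomputable def coeffMat {n : ℕ} (ψ : QuadraticForm F (Fin n → F)) :
    Matrix (Fin n) (Fin n) F :=
  Matrix.of fun i j =>
    if i = j then ψ (Pi.single i 1)
    else if i < j then polar ψ (Pi.single i 1) (Pi.single j 1) else 0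

/-- The homogeneous degree 2 polynomial `P_ψ` associated to a quadratic form `ψ`. -/
noncomputable def qfPoly {n : ℕ} (ψ : QuadraticForm F (Fin n → F)) :
    MvPolynomial (Fin n) F :=
  ∑ i : Fin n, ∑ j : Fin n, MvPolynomial.C (coeffMat F ψ i j) * (X i * X j)

/-- The affine coordinate ring `F[x₁,…,xₙ]/(P_ψ)` of the quadric `ψ = 0`. -/
def FunFieldRing {n : ℕ} (ψ : QuadraticForm F (Fin n → F)) : Type :=
  MvPolynomial (Fin n) F ⧸ Ideal.span {qfPoly F ψ}

noncomputable instance {n : ℕ} (ψ : QuadraticForm F (Fin n → F)) :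
    CommRing (FunFieldRing F ψ) :=
  inferInstanceAs (CommRing (MvPolynomial (Fin n) F ⧸ Ideal.span {qfPoly F ψ}))

noncomputable instance {n : ℕ} (ψ : QuadraticForm F (Fin n → F)) :
    Algebra F (FunFieldRing F ψ) :=
  inferInstanceAs (Algebra F (MvPolynomial (Fin n) F ⧸ Ideal.span {qfPoly F ψ}))

/-- The function field `F(ψ)` of the quadric `ψ = 0`. -/
def FunField {n : ℕ} (ψ : QuadraticForm F (Fin n → F)) : Type :=
  FractionRing (FunFieldRing F ψ)

noncomputable instance {n : ℕ} (ψ : QuadraticForm F (Fin n → F)) :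
    CommRing (FunField F ψ) :=
  inferInstanceAs (CommRing (FractionRing (FunFieldRing F ψ)))

noncomputable instance {n : ℕ} (ψ : QuadraticForm F (Fin n → F)) :
    Algebra (FunFieldRing F ψ) (FunField F ψ) :=
  inferInstanceAs (Algebra (FunFieldRing F ψ) (FractionRing (FunFieldRing F ψ)))

noncomputable instance {n : ℕ} (ψ : QuadraticForm F (Fin n → F)) :
    Algebra F (FunField F ψ) :=
  inferInstanceAs (Algebra F (FractionRing (FunFieldRing F ψ)))

/-- The canonical map `F → F(ψ)`. -/
noncomputable def funFieldMap {n : ℕ} (ψ : QuadraticForm F (Fin n → F)) :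
    F →+* FunField F ψ :=
  algebraMap F (FunField F ψ)

/-- Scalar extension of a quadratic form on `Fin n → F` along a ring homomorphism
`f : F → K`. -/
noncomputable def extendQF {K : Type} [CommRing K] (f : F →+* K) {n : ℕ}
    (φ : QuadraticForm F (Fin n → F)) : QuadraticForm K (Fin n → K) :=
  ((coeffMat F φ).map f).toQuadraticMap'

end FunField


section Quat

variable (K : Type) [CommRing K]

/-- Defining relations for the char-2 quaternion algebra `[a,b)`: generators `i,j` with
`i² + i = a`, `j² = b`, `j·i = i·j + j` (i.e. `j·i·j⁻¹ = i + 1`). -/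
inductive QuatRel (a b : K) : FreeAlgebra K (Fin 2) → FreeAlgebra K (Fin 2) → Prop
  | i_sq : QuatRel a b (FreeAlgebra.ι K 0 * FreeAlgebra.ι K 0 + FreeAlgebra.ι K 0)
      (algebraMap K _ a)
  | j_sq : QuatRel a b (FreeAlgebra.ι K 1 * FreeAlgebra.ι K 1) (algebraMap K _ b)
  | swap : QuatRel a b (FreeAlgebra.ι K 1 * FreeAlgebra.ι K 0)
      (FreeAlgebra.ι K 0 * FreeAlgebra.ι K 1 + FreeAlgebra.ι K 1)

/-- The quaternion algebra `[a,b)` over `K` (characteristic two convention). -/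
def QuatAlg (a b : K) : Type := RingQuot (QuatRel K a b)

noncomputable instance (a b : K) : Ring (QuatAlg K a b) :=
  inferInstanceAs (Ring (RingQuot (QuatRel K a b)))
noncomputable instance (a b : K) : Algebra K (QuatAlg K a b) :=
  inferInstanceAs (Algebra K (RingQuot (QuatRel K a b)))

/-- `[a,b)` is split over `K`: isomorphic to the `2×2` matrix algebra. -/
def QuatSplit (a b : K) : Prop :=
  Nonempty (QuatAlg K a b ≃ₐ[K] Matrix (Fin 2) (Fin 2) K)

end Quat

section Sqrt

variable (F : Type) [Field F]

/-- The field `F(√c₁,…,√c_s)` obtained by adjoining square roots of the `cᵢ`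
(inside an algebraic closure of `F`). -/
noncomputable def sqrtExt {s : ℕ} (c : Fin s → F) :
    IntermediateField F (AlgebraicClosure F) :=
  IntermediateField.adjoin F
    {y : AlgebraicClosure F | ∃ i, y ^ 2 = algebraMap F (AlgebraicClosure F) (c i)}

/-- The subfield `F² = {x² : x ∈ F}` of squares of a field of characteristic 2. -/
noncomputable def sqSubfield : Subfield F := Subfield.closure (Set.range fun x : F => x ^ 2)

set_option synthInstance.maxHeartbeats 1000000 in
/-- The norm degree `[F²(cᵢ·cⱼ) : F²]` of a diagonal form `⟨c₁,…,c_s⟩`. -/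
noncomputable def normDegree {s : ℕ} (c : Fin s → F) : ℕ :=
  Module.finrank (sqSubfield F)
    (IntermediateField.adjoin (sqSubfield F)
      (Set.range fun p : Fin s × Fin s => c p.1 * c p.2))

end Sqrt

/-- A ring is a division algebra if it is nontrivial and every nonzero element is a unit. -/
def IsDivisionAlgebra (T : Type) [Ring T] : Prop :=
  (0 : T) ≠ 1 ∧ ∀ x : T, x ≠ 0 → IsUnit x

section Lattice

/-- Right ideals of a polynomial ring over a division ring are principal. -/
lemma exists_generator_of_rightIdeal {D : Type*} [Ring D] [Nontrivial D]
    (hD : ∀ d : D, d ≠ 0 → IsUnit d) (I : AddSubgroup (Polynomial D))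
    (hI : ∀ p ∈ I, ∀ q, p * q ∈ I) : ∃ u ∈ I, ∀ p ∈ I, ∃ q, p = u * q := by
  classical
  by_cases h0 : ∃ p ∈ I, p ≠ 0
  · have hex : ∃ n : ℕ, ∃ p ∈ I, p ≠ 0 ∧ p.natDegree = n := by
      obtain ⟨p, hp, hp0⟩ := h0
      exact ⟨_, p, hp, hp0, rfl⟩
    obtain ⟨p, hp, hp0, hdeg⟩ := Nat.find_spec hex
    obtain ⟨v, hv⟩ := (hD _ (Polynomial.leadingCoeff_ne_zero.2 hp0)).exists_right_inv
    have hlead : p.leadingCoeff * (Polynomial.C v).leadingCoeff = 1 := by simpa using hv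
    have hmon : (p * Polynomial.C v).Monic := by
      rw [Polynomial.Monic, Polynomial.leadingCoeff_mul' (by rw [hlead]; exact one_ne_zero), hlead]
    have hle : (p * Polynomial.C v).natDegree ≤ p.natDegree :=
      (Polynomial.natDegree_mul_le).trans (by simp)
    refine ⟨p * Polynomial.C v, hI _ hp _, fun q hq ↦ ⟨q /ₘ (p * Polynomial.C v), ?_⟩⟩
    by_contra hne
    have hr : q %ₘ (p * Polynomial.C v) ≠ 0 := fun h ↦ hne (by
      conv_lhs => rw [← Polynomial.modByMonic_add_div q (p * Polynomial.C v), h, zero_add])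
    have hrI : q %ₘ (p * Polynomial.C v) ∈ I := by
      rw [Polynomial.modByMonic_eq_sub_mul_div]
      exact I.sub_mem hq (hI _ (hI _ hp _) _)
    have hlt := Polynomial.natDegree_lt_natDegree hr (Polynomial.degree_modByMonic_lt q hmon)
    exact Nat.find_min hex (m := (q %ₘ (p * Polynomial.C v)).natDegree) (by omega)
      ⟨_, hrI, hr, rfl⟩
  · push Not at h0
    exact ⟨0, I.zero_mem, fun p hp ↦ ⟨0, by simp [h0 p hp]⟩⟩

variable {R A κ : Type*} [Ring R] [Ring A] (ι : R →+* A) (z : κ → A)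

/-- A family of elements with central Clifford-type relations stabilises a fractional right
ideal. -/
lemma exists_stable_lattice (S : Submonoid R) (hS : ∀ h ∈ S, ∀ a, Commute (ι h) a)
    (hden : ∀ a : A, ∃ h ∈ S, ∃ p, ι h * a = ι p)
    (hsq : ∀ i, ∃ r, z i * z i = ι r ∧ ∀ a, Commute (ι r) a)
    (hpol : ∀ i j, ∃ r, z i * z j + z j * z i = ι r ∧ ∀ a, Commute (ι r) a) (s : Finset κ) :
    ∃ J : AddSubgroup A, 1 ∈ J ∧ (∀ a ∈ J, ∀ p, a * ι p ∈ J) ∧ (∀ i ∈ s, ∀ a ∈ J, z i * a ∈ J) ∧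
      ∃ h ∈ S, ∀ a ∈ J, ∃ p, ι h * a = ι p := by
  classical
  induction s using Finset.induction_on with
  | empty =>
    refine ⟨ι.range.toAddSubgroup, ι.range.one_mem, ?_, by simp, 1, S.one_mem, ?_⟩
    · rintro _ ⟨q, rfl⟩ p
      exact ⟨q * p, by simp⟩
    · rintro _ ⟨q, rfl⟩
      exact ⟨q, by simp⟩
  | insert l s hl ih =>
    obtain ⟨J, h1, hmul, hst, h, hh, hb⟩ := ih
    refine ⟨J ⊔ J.map (AddMonoidHom.mulLeft (z l)), AddSubgroup.mem_sup_left h1, ?_, ?_, ?_⟩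
    · intro a ha p
      obtain ⟨x, hx, _, ⟨y, hy, rfl⟩, rfl⟩ := AddSubgroup.mem_sup.1 ha
      rw [add_mul]
      refine AddSubgroup.add_mem_sup (hmul _ hx _) ⟨y * ι p, hmul _ hy _, ?_⟩
      simp [mul_assoc]
    · have hin : ∀ r, (∀ a, Commute (ι r) a) → ∀ a ∈ J, ι r * a ∈ J := fun r hr a ha ↦ by
        rw [(hr a).eq]
        exact hmul _ ha _
      intro i hi a ha
      obtain ⟨x, hx, _, ⟨y, hy, rfl⟩, rfl⟩ := AddSubgroup.mem_sup.1 ha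
      rcases Finset.mem_insert.1 hi with rfl | hi
      · obtain ⟨r, hr, hc⟩ := hsq i
        have : z i * (x + AddMonoidHom.mulLeft (z i) y)
            = ι r * y + AddMonoidHom.mulLeft (z i) x := by
          simp only [AddMonoidHom.coe_mulLeft, ← hr]
          noncomm_ring
        rw [this]
        exact AddSubgroup.add_mem_sup (hin r hc y hy) ⟨x, hx, rfl⟩
      · obtain ⟨r, hr, hc⟩ := hpol i l
        have : z i * (x + AddMonoidHom.mulLeft (z l) y)
            = (z i * x + ι r * y) + AddMonoidHom.mulLeft (z l) (-(z i * y)) := by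
          simp only [AddMonoidHom.coe_mulLeft, ← hr]
          noncomm_ring
        rw [this]
        exact AddSubgroup.add_mem_sup (J.add_mem (hst i hi x hx) (hin r hc y hy))
          ⟨_, J.neg_mem (hst i hi y hy), rfl⟩
    · obtain ⟨g, hg, q, hq⟩ := hden (z l)
      refine ⟨g * h, S.mul_mem hg hh, fun a ha ↦ ?_⟩
      obtain ⟨x, hx, _, ⟨y, hy, rfl⟩, rfl⟩ := AddSubgroup.mem_sup.1 ha
      obtain ⟨p, hp⟩ := hb x hx
      obtain ⟨p', hp'⟩ := hb y hy
      refine ⟨g * p + q * p', ?_⟩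
      simp only [map_add, map_mul, ← hp, ← hp', ← hq, AddMonoidHom.coe_mulLeft, mul_add]
      rw [mul_assoc, mul_assoc, mul_assoc, ← mul_assoc (ι h) (z l), (hS h hh (z l)).eq]
      simp only [mul_assoc]

/-- If right ideals of `R` are principal, such a family is simultaneously conjugate to a family
in `R`. -/
lemma exists_conj [Finite κ]
    (hR : ∀ I : AddSubgroup R, (∀ p ∈ I, ∀ q, p * q ∈ I) → ∃ u ∈ I, ∀ p ∈ I, ∃ q, p = u * q)
    (S : Submonoid R) (hS0 : (0 : R) ∉ S) (hS : ∀ h ∈ S, ∀ a, Commute (ι h) a)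
    (hden : ∀ a : A, ∃ h ∈ S, ∃ p, ι h * a = ι p)
    (hsq : ∀ i, ∃ r, z i * z i = ι r ∧ ∀ a, Commute (ι r) a)
    (hpol : ∀ i j, ∃ r, z i * z j + z j * z i = ι r ∧ ∀ a, Commute (ι r) a) :
    ∃ u : R, u ≠ 0 ∧ ∃ w : κ → R, ∀ i, z i * ι u = ι u * ι (w i) := by
  classical
  cases nonempty_fintype κ
  obtain ⟨J, h1, hmul, hst, h, hh, hb⟩ :=
    exists_stable_lattice ι z S hS hden hsq hpol Finset.univ
  let I : AddSubgroup R := (J.map (AddMonoidHom.mulLeft (ι h))).comap (ι : R →+ A)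
  have hmem : ∀ p, p ∈ I ↔ ∃ a ∈ J, ι h * a = ι p := fun p ↦ Iff.rfl
  have hI : ∀ p ∈ I, ∀ q, p * q ∈ I := by
    intro p hp q
    obtain ⟨a, ha, hp⟩ := (hmem _).1 hp
    exact (hmem _).2 ⟨a * ι q, hmul a ha q, by rw [map_mul, ← hp, mul_assoc]⟩
  obtain ⟨u, hu, hgen⟩ := hR I hI
  refine ⟨u, ?_, ?_⟩
  · rintro rfl
    obtain ⟨q, hq⟩ := hgen h ((hmem _).2 ⟨1, h1, mul_one _⟩)
    exact hS0 (by simpa [hq] using hh)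
  · obtain ⟨a, ha, hua⟩ := (hmem _).1 hu
    have (i : κ) : ∃ w, z i * ι u = ι u * ι w := by
      obtain ⟨p, hp⟩ := hb _ (hst i (Finset.mem_univ _) a ha)
      obtain ⟨w, hw⟩ := hgen p ((hmem _).2 ⟨_, hst i (Finset.mem_univ _) a ha, hp⟩)
      refine ⟨w, ?_⟩
      rw [← map_mul, ← hw, ← hp, ← hua, ← mul_assoc, ← mul_assoc, (hS h hh _).eq]
    choose w hw using this
    exact ⟨w, hw⟩

end Lattice

section PolynomialTensor

variable (F D L : Type*) [Field F] [Ring D] [Algebra F D] [Field L] [Algebra F L]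
  [Algebra (Polynomial F) L] [IsScalarTower F (Polynomial F) L]

/-- The canonical map `D[X] → F(X) ⊗ D`. -/
noncomputable def polyToTensor : Polynomial D →ₐ[F] L ⊗[F] D :=
  ((Algebra.TensorProduct.comm F D L).toAlgHom.comp
    (Algebra.TensorProduct.map (AlgHom.id F D) (IsScalarTower.toAlgHom F (Polynomial F) L))).comp
    (polyEquivTensor F D).toAlgHom

lemma polyToTensor_symm_tmul (d : D) (p : Polynomial F) :
    polyToTensor F D L ((polyEquivTensor F D).symm (d ⊗ₜ p)) = algebraMap _ L p ⊗ₜ d := by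
  change Algebra.TensorProduct.comm F D L (Algebra.TensorProduct.map (AlgHom.id F D)
    (IsScalarTower.toAlgHom F (Polynomial F) L)
    (polyEquivTensor F D ((polyEquivTensor F D).symm (d ⊗ₜ p)))) = _
  rw [AlgEquiv.apply_symm_apply]
  simp

lemma polyToTensor_map (p : Polynomial F) :
    polyToTensor F D L (p.map (algebraMap F D)) = algebraMap L _ (algebraMap _ L p) := by
  have := polyToTensor_symm_tmul F D L 1 p
  rw [polyEquivTensor_symm_apply_tmul_eq_smul, one_smul] at this
  simpa using this

lemma polyToTensor_injective [FaithfulSMul (Polynomial F) L] :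
    Function.Injective (polyToTensor F D L) := by
  have h : Function.Injective
      ((IsScalarTower.toAlgHom F (Polynomial F) L).toLinearMap.lTensor D) :=
    Module.Flat.lTensor_preserves_injective_linearMap _
      (FaithfulSMul.algebraMap_injective (Polynomial F) L)
  exact ((Algebra.TensorProduct.comm F D L).injective.comp h).comp (polyEquivTensor F D).injective

lemma exists_algebraMap_mul_eq_polyToTensor [IsFractionRing (Polynomial F) L] (a : L ⊗[F] D) :
    ∃ h : Polynomial F, h ≠ 0 ∧ ∃ p,
      algebraMap L (L ⊗[F] D) (algebraMap _ L h) * a = polyToTensor F D L p := by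
  induction a using TensorProduct.induction_on with
  | zero => exact ⟨1, one_ne_zero, 0, by simp⟩
  | tmul x d =>
    obtain ⟨p, h, hh, rfl⟩ := IsFractionRing.div_surjective (A := Polynomial F) x
    have hh0 : h ≠ 0 := nonZeroDivisors.ne_zero hh
    have hh1 : algebraMap (Polynomial F) L h ≠ 0 := by
      simpa using hh0
    refine ⟨h, hh0, _, Eq.trans ?_ (polyToTensor_symm_tmul F D L d p).symm⟩
    rw [Algebra.TensorProduct.algebraMap_apply, Algebra.TensorProduct.tmul_mul_tmul]
    simp [mul_div_cancel₀ _ hh1]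
  | add a b iha ihb =>
    obtain ⟨h, hh, p, hp⟩ := iha
    obtain ⟨g, hg, q, hq⟩ := ihb
    refine ⟨g * h, mul_ne_zero hg hh,
      g.map (algebraMap F D) * p + h.map (algebraMap F D) * q, ?_⟩
    simp only [map_add, map_mul, polyToTensor_map, ← hp, ← hq, mul_add]
    rw [(Algebra.commute_algebraMap_left (algebraMap _ L g)
      (algebraMap L (L ⊗[F] D) (algebraMap _ L h))).eq]
    simp only [mul_assoc]
    rw [← mul_assoc (algebraMap L (L ⊗[F] D) (algebraMap _ L h)), (Algebra.commute_algebraMap_left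
      (algebraMap _ L h) (algebraMap L (L ⊗[F] D) (algebraMap _ L g))).eq]
    simp only [mul_assoc]

instance isDomain_fractionRing_tensor [IsDomain D] [IsFractionRing (Polynomial F) L] :
    IsDomain (L ⊗[F] D) := by
  have hinj := polyToTensor_injective F D L
  have : Nontrivial (L ⊗[F] D) := hinj.nontrivial
  have hc : ∀ h : Polynomial F, h ≠ 0 →
      IsUnit (algebraMap L (L ⊗[F] D) (algebraMap _ L h)) := fun h hh ↦
    (IsUnit.mk0 _ (by simpa using hh)).map _
  have : NoZeroDivisors (L ⊗[F] D) := by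
    refine ⟨fun {a b} hab ↦ ?_⟩
    obtain ⟨h, hh, p, hp⟩ := exists_algebraMap_mul_eq_polyToTensor F D L a
    obtain ⟨g, hg, q, hq⟩ := exists_algebraMap_mul_eq_polyToTensor F D L b
    have : p * q = 0 := by
      apply hinj
      rw [map_mul, map_zero, ← hp, ← hq, mul_assoc, ← mul_assoc a,
        ← (Algebra.commute_algebraMap_left _ a).eq, mul_assoc, hab]
      simp
    rcases mul_eq_zero.1 this with rfl | rfl
    · left
      exact (hc h hh).mul_right_eq_zero.1 (hp.trans (map_zero _))
    · right
      exact (hc g hg).mul_right_eq_zero.1 (hq.trans (map_zero _))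
  exact NoZeroDivisors.to_isDomain _

end PolynomialTensor

lemma isUnit_of_finite_of_ne_zero (F : Type*) {D : Type*} [Field F] [Ring D] [IsDomain D]
    [Algebra F D] [FiniteDimensional F D] (d : D) (hd : d ≠ 0) : IsUnit d := by
  obtain ⟨v, hv⟩ := FiniteDimensional.exists_mul_eq_one F hd
  exact IsUnit.of_mul_eq_one v hv

section CliffordRel

/-- The family `z` satisfies the defining relations of the Clifford algebra of the quadratic form
`v ↦ ∑ M i j * v i * v j`. -/
def CliffordRel {F D : Type*} [CommRing F] [Ring D] [Algebra F D] {κ : Type*} (M : Matrix κ κ F)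
    (z : κ → D) : Prop :=
  (∀ i, z i * z i = algebraMap F D (M i i)) ∧
    ∀ i j, z i * z j + z j * z i = algebraMap F D (M i j + M j i)

/-- Restriction of the form with matrix `M` to the span of `e₀ + X e₁, e₂, e₃, …`. -/
noncomputable def genericMatrix {F : Type*} [CommRing F] {k : ℕ}
    (M : Matrix (Fin (k + 2)) (Fin (k + 2)) F) :
    Matrix (Fin (k + 1)) (Fin (k + 1)) (Polynomial F) :=
  Matrix.of (Fin.cons
    (Fin.cons (Polynomial.C (M 0 0) + Polynomial.C (M 0 1 + M 1 0) * Polynomial.X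
        + Polynomial.C (M 1 1) * Polynomial.X ^ 2)
      fun j ↦ Polynomial.C (M 0 j.succ.succ) + Polynomial.C (M 1 j.succ.succ) * Polynomial.X)
    fun i ↦ Fin.cons
      (Polynomial.C (M i.succ.succ 0) + Polynomial.C (M i.succ.succ 1) * Polynomial.X)
      fun j ↦ Polynomial.C (M i.succ.succ j.succ.succ))

variable {F D : Type*} [Field F] [Ring D] [IsDomain D] [Algebra F D]

lemma CliffordRel.of_polynomial {k : ℕ} {M : Matrix (Fin (k + 2)) (Fin (k + 2)) F}
    {w : Fin (k + 1) → Polynomial D}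
    (hsq : ∀ i, w i * w i = (genericMatrix M i i).map (algebraMap F D))
    (hpol : ∀ i j, w i * w j + w j * w i =
      (genericMatrix M i j + genericMatrix M j i).map (algebraMap F D)) :
    ∃ z : Fin (k + 2) → D, CliffordRel M z := by
  have hdeg0 : (w 0).natDegree ≤ 1 := by
    have h : (w 0 * w 0).natDegree ≤ 2 := by
      rw [hsq 0]
      refine (Polynomial.natDegree_map_le).trans ?_
      simp only [genericMatrix, Matrix.of_apply, Fin.cons_zero]
      compute_degree
    by_cases h0 : w 0 = 0
    · simp [h0]
    · rw [Polynomial.natDegree_mul h0 h0] at h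
      omega
  have hdegS : ∀ i : Fin k, (w i.succ).natDegree ≤ 0 := fun i ↦ by
    have h : (w i.succ * w i.succ).natDegree ≤ 0 := by
      rw [hsq i.succ]
      refine (Polynomial.natDegree_map_le).trans ?_
      simp [genericMatrix]
    by_cases h0 : w i.succ = 0
    · simp [h0]
    · rw [Polynomial.natDegree_mul h0 h0] at h
      omega
  obtain ⟨d₁, d₀, hw0⟩ := Polynomial.exists_eq_X_add_C_of_natDegree_le_one hdeg0
  have hwS : ∀ i : Fin k, w i.succ = Polynomial.C ((w i.succ).coeff 0) := fun i ↦
    Polynomial.eq_C_of_natDegree_le_zero (hdegS i)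
  set y : Fin k → D := fun i ↦ (w i.succ).coeff 0 with hy
  obtain ⟨q, hq⟩ : ∃ q, q = d₁ * d₁ := ⟨_, rfl⟩
  have e00 : (Polynomial.C q * Polynomial.X ^ 2
      + Polynomial.C (d₀ * d₁ + d₁ * d₀) * Polynomial.X + Polynomial.C (d₀ * d₀)) =
      (genericMatrix M 0 0).map (algebraMap F D) := by
    rw [← hsq 0, hw0, hq]
    simp only [map_add, map_mul, add_mul, mul_add, pow_two]
    simp only [mul_assoc, Polynomial.X_mul]
    abel
  have e0S (i : Fin k) : (Polynomial.C (d₁ * y i + y i * d₁) * Polynomial.X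
      + Polynomial.C (d₀ * y i + y i * d₀)) =
      (genericMatrix M 0 i.succ + genericMatrix M i.succ 0).map (algebraMap F D) := by
    rw [← hpol 0 i.succ, hw0, hwS i]
    simp only [map_add, map_mul, add_mul, mul_add]
    simp only [mul_assoc, Polynomial.X_mul_C, hy]
    abel
  have c00 (n : ℕ) := congrArg (fun p ↦ p.coeff n) e00
  have c0S (n : ℕ) (i : Fin k) := congrArg (fun p ↦ p.coeff n) (e0S i)
  have a0 := c00 0
  have a1 := c00 1
  have a2 := c00 2
  have b0 := c0S 0
  have b1 := c0S 1
  have sS (i j : Fin k) : y i * y j + y j * y i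
      = algebraMap F D (M i.succ.succ j.succ.succ + M j.succ.succ i.succ.succ) := by
    apply Polynomial.C_injective
    have := hpol i.succ j.succ
    rw [hwS i, hwS j] at this
    simpa [genericMatrix] using this
  have qS (i : Fin k) : y i * y i = algebraMap F D (M i.succ.succ i.succ.succ) := by
    apply Polynomial.C_injective
    have := hsq i.succ
    rw [hwS i] at this
    simpa [genericMatrix] using this
  simp [genericMatrix, Polynomial.coeff_X, Polynomial.coeff_C, Polynomial.coeff_X_pow] at a0 a1 a2 b0 b1
  refine ⟨Fin.cons d₀ (Fin.cons d₁ y), ?_, ?_⟩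
  · intro i
    refine Fin.cases ?_ (fun i ↦ Fin.cases ?_ (fun i ↦ ?_) i) i
    · simpa using a0
    · simpa [← hq] using a2
    · simpa using qS i
  · intro i j
    refine Fin.cases ?_ (fun i ↦ Fin.cases ?_ (fun i ↦ ?_) i) i <;>
    refine Fin.cases ?_ (fun j ↦ Fin.cases ?_ (fun j ↦ ?_) j) j
    · simp [a0]
    · simpa using a1
    · simpa using b0 j
    · simpa [add_comm] using a1
    · simp [← hq, a2]
    · simpa using b1 j
    · simpa [add_comm] using b0 i
    · simpa [add_comm] using b1 i
    · simpa using sS i j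

/-- A Clifford family over `F(X)` for the form generically restricted along `X` gives a Clifford
family over `F` for the original form. -/
lemma CliffordRel.descend (L : Type*) [Field L] [Algebra F L] [FiniteDimensional F D]
    [Algebra (Polynomial F) L] [IsScalarTower F (Polynomial F) L] [IsFractionRing (Polynomial F) L]
    {k : ℕ} {M : Matrix (Fin (k + 2)) (Fin (k + 2)) F} {z : Fin (k + 1) → L ⊗[F] D}
    (hz : CliffordRel ((genericMatrix M).map (algebraMap (Polynomial F) L)) z) :
    ∃ z : Fin (k + 2) → D, CliffordRel M z := by
  let ι : Polynomial D →+* L ⊗[F] D := (polyToTensor F D L : Polynomial D →+* L ⊗[F] D)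
  have hι : Function.Injective ι := polyToTensor_injective F D L
  have hmap (p : Polynomial F) : ι (p.map (algebraMap F D)) =
    algebraMap L _ (algebraMap _ L p) := polyToTensor_map F D L p
  have hcomm (p : Polynomial F) (a : L ⊗[F] D) : Commute (ι (p.map (algebraMap F D))) a := by
    rw [hmap]
    exact Algebra.commute_algebraMap_left _ a
  have hsq (i) : z i * z i = ι ((genericMatrix M i i).map (algebraMap F D)) := by
    rw [hmap, hz.1 i, Matrix.map_apply]
  have hpol (i j) : z i * z j + z j * z i =
      ι ((genericMatrix M i j + genericMatrix M j i).map (algebraMap F D)) := by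
    rw [hmap, hz.2 i j, Matrix.map_apply, Matrix.map_apply, map_add (algebraMap (Polynomial F) L)]
  obtain ⟨u, hu, w, hw⟩ := exists_conj ι z
    (exists_generator_of_rightIdeal (isUnit_of_finite_of_ne_zero F))
    ((nonZeroDivisors (Polynomial F)).map (Polynomial.mapRingHom (algebraMap F D)))
    (by
      rintro ⟨h, hh, h0⟩
      exact nonZeroDivisors.ne_zero hh
        ((Polynomial.map_eq_zero_iff (algebraMap F D).injective).1 h0))
    (by
      rintro _ ⟨h, -, rfl⟩ a
      exact hcomm h a)
    (fun a ↦ by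
      obtain ⟨h, hh, p, hp⟩ := exists_algebraMap_mul_eq_polyToTensor F D L a
      exact ⟨_, ⟨h, mem_nonZeroDivisors_of_ne_zero hh, rfl⟩, p, by
        rw [← hmap h] at hp
        exact hp⟩)
    (fun i ↦ ⟨_, hsq i, hcomm _⟩) (fun i j ↦ ⟨_, hpol i j, hcomm _⟩)
  have hww (i j) : z i * z j * ι u = ι u * ι (w i * w j) := by
    rw [mul_assoc, hw, ← mul_assoc, hw, mul_assoc, map_mul]
  refine CliffordRel.of_polynomial (w := w) (fun i ↦ ?_) (fun i j ↦ ?_)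
  · apply mul_left_cancel₀ hu
    apply hι
    rw [map_mul, ← hww, hsq, (hcomm _ _).eq, map_mul]
  · apply mul_left_cancel₀ hu
    apply hι
    rw [map_mul, map_add ι, mul_add, ← hww, ← hww, ← add_mul, hpol, (hcomm _ _).eq, map_mul]

end CliffordRel

section Generic

lemma sum_genericMatrix {F E : Type*} [CommRing F] [CommRing E] [Algebra F E]
    [Algebra (Polynomial F) E] [IsScalarTower F (Polynomial F) E] {k : ℕ}
    (M : Matrix (Fin (k + 2)) (Fin (k + 2)) F) (x : Fin k → E) :
    ∑ i, ∑ j, algebraMap (Polynomial F) E (genericMatrix M i j) *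
      ((Fin.cons 1 x : Fin (k + 1) → E) i * (Fin.cons 1 x : Fin (k + 1) → E) j) =
    ∑ i, ∑ j, algebraMap F E (M i j) *
      ((Fin.cons 1 (Fin.cons (algebraMap (Polynomial F) E Polynomial.X) x) : Fin (k + 2) → E) i *
        (Fin.cons 1 (Fin.cons (algebraMap (Polynomial F) E Polynomial.X) x) :
          Fin (k + 2) → E) j) := by
  have hC (a : F) : algebraMap (Polynomial F) E (Polynomial.C a) = algebraMap F E a :=
    (IsScalarTower.algebraMap_apply F (Polynomial F) E a).symm
  simp only [Fin.sum_univ_succ, genericMatrix, Matrix.of_apply, Fin.cons_zero, Fin.cons_succ,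
    map_add, map_mul, map_pow, hC, Finset.sum_add_distrib, add_mul, Fin.succ_zero_eq_one]
  have h1 (g : Fin k → F) (t : E) : ∑ i, algebraMap F E (g i) * t * (1 * x i)
      = ∑ i, algebraMap F E (g i) * (t * x i) :=
    Finset.sum_congr rfl fun i _ ↦ by ring
  have h2 (g : Fin k → F) (t : E) : ∑ i, algebraMap F E (g i) * t * (x i * 1)
      = ∑ i, algebraMap F E (g i) * (x i * t) :=
    Finset.sum_congr rfl fun i _ ↦ by ring
  rw [h1, h2]
  ring

/-- The isomorphism `A ⊗[S] (S ⊗[R] B) ≃ₐ[A] A ⊗[R] B` for a noncommutative algebra `B`. -/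
noncomputable def cancelBaseChangeRing (R S A B : Type*) [CommRing R] [CommRing S] [CommRing A]
    [Ring B] [Algebra R S] [Algebra R A] [Algebra R B] [Algebra S A] [IsScalarTower R S A] :
    A ⊗[S] (S ⊗[R] B) ≃ₐ[A] A ⊗[R] B :=
  AlgEquiv.symm <| AlgEquiv.ofLinearEquiv
    (TensorProduct.AlgebraTensorModule.cancelBaseChange R S A A B).symm
    (by simp [Algebra.TensorProduct.one_def]) <|
      LinearMap.map_mul_of_map_mul_tmul (fun _ _ _ _ ↦ by simp)

/-- Generic descent: there is a purely transcendental extension over which `D` stays a division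
algebra and such that a square root of the generic value of a quadratic form yields a Clifford
family in `D`. -/
theorem exists_generic (k : ℕ) : ∀ (F D : Type) [Field F] [Ring D] [IsDomain D] [Algebra F D]
    [FiniteDimensional F D], ∃ (E : Type) (_ : Field E) (_ : Algebra F E) (x : Fin k → E),
      AlgebraicIndependent F x ∧ IsDomain (E ⊗[F] D) ∧
      ∀ M : Matrix (Fin (k + 1)) (Fin (k + 1)) F,
        (∃ s : E ⊗[F] D, s * s = algebraMap E _ (∑ i, ∑ j, algebraMap F E (M i j) *
          ((Fin.cons 1 x : Fin (k + 1) → E) i * (Fin.cons 1 x : Fin (k + 1) → E) j))) →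
        ∃ z : Fin (k + 1) → D, CliffordRel M z := by
  induction k with
  | zero =>
    intro F D _ _ _ _ _
    refine ⟨F, inferInstance, inferInstance, Fin.elim0, algebraicIndependent_empty_type,
      (Algebra.TensorProduct.lid F D).toMulEquiv.isDomain _, fun M ⟨s, hs⟩ ↦
      ⟨fun _ ↦ Algebra.TensorProduct.lid F D s, ?_⟩⟩
    have h : Algebra.TensorProduct.lid F D s * Algebra.TensorProduct.lid F D s =
        algebraMap F D (M 0 0) := by
      rw [← map_mul, hs]
      simp [Algebra.algebraMap_eq_smul_one]
    refine ⟨fun i ↦ by simpa [Fin.eq_zero i] using h, fun i j ↦ ?_⟩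
    simp [Fin.eq_zero i, Fin.eq_zero j, h]
  | succ k ih =>
    intro F D _ _ _ _ _
    let L := FractionRing (Polynomial F)
    obtain ⟨E, _, _, x, hx, hdom, hM⟩ := ih L (L ⊗[F] D)
    let _ : Algebra F E := ((algebraMap L E).comp (algebraMap F L)).toAlgebra
    have : IsScalarTower F L E := IsScalarTower.of_algebraMap_eq fun _ ↦ rfl
    let _ : Algebra (Polynomial F) E :=
      ((algebraMap L E).comp (algebraMap (Polynomial F) L)).toAlgebra
    have : IsScalarTower (Polynomial F) L E := IsScalarTower.of_algebraMap_eq fun _ ↦ rfl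
    have : IsScalarTower F (Polynomial F) E := IsScalarTower.of_algebraMap_eq fun a ↦ by
      rw [IsScalarTower.algebraMap_apply F L E, IsScalarTower.algebraMap_apply F (Polynomial F) L,
        ← IsScalarTower.algebraMap_apply (Polynomial F) L E]
    let e := cancelBaseChangeRing F L E D
    refine ⟨E, inferInstance, inferInstance,
      Fin.cons (algebraMap (Polynomial F) E Polynomial.X) x, ?_,
      e.symm.toMulEquiv.isDomain _, fun M ⟨s, hs⟩ ↦ ?_⟩
    · have ht : AlgebraicIndependent F
          (fun _ : Fin 1 ↦ algebraMap (Polynomial F) L Polynomial.X) := by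
        rw [algebraicIndependent_unique_type_iff, transcendental_algebraMap_iff
          (FaithfulSMul.algebraMap_injective (Polynomial F) L)]
        exact Polynomial.transcendental_X F
      let f : Fin (k + 1) → Fin k ⊕ Fin 1 := Fin.cons (Sum.inr 0) Sum.inl
      have hf : Function.Injective f := by
        intro i j
        refine Fin.cases ?_ (fun i ↦ ?_) i <;> refine Fin.cases ?_ (fun j ↦ ?_) j <;> simp [f]
      convert (ht.sumElim_comp hx).comp f hf using 1
      funext i
      refine Fin.cases ?_ (fun i ↦ ?_) i
      · simp [f, IsScalarTower.algebraMap_apply (Polynomial F) L E]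
      · simp [f]
    · refine CliffordRel.descend L (hM _ ⟨e.symm s, ?_⟩).choose_spec
      rw [← map_mul, hs, AlgEquiv.commutes, ← sum_genericMatrix]
      simp only [Matrix.map_apply, ← IsScalarTower.algebraMap_apply]

end Generic

section QuadraticExtension

lemma exists_eq_add_root_tmul {E A : Type*} [Field E] [Ring A] [Algebra E A] (g : E)
    (u : AdjoinRoot (Polynomial.X ^ 2 - Polynomial.C g) ⊗[E] A) :
    ∃ α β : A, u = 1 ⊗ₜ α + AdjoinRoot.root (Polynomial.X ^ 2 - Polynomial.C g) ⊗ₜ β := by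
  have hmon : (Polynomial.X ^ 2 - Polynomial.C g).Monic := Polynomial.monic_X_pow_sub_C g two_ne_zero
  induction u using TensorProduct.induction_on with
  | zero => exact ⟨0, 0, by simp⟩
  | add u v hu hv =>
    obtain ⟨α, β, rfl⟩ := hu
    obtain ⟨γ, δ, rfl⟩ := hv
    refine ⟨α + γ, β + δ, ?_⟩
    simp only [TensorProduct.tmul_add]
    abel
  | tmul y a =>
    obtain ⟨p, rfl⟩ := AdjoinRoot.mk_surjective y
    have hdeg : (p %ₘ (Polynomial.X ^ 2 - Polynomial.C g)).natDegree ≤ 1 := by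
      have := Polynomial.natDegree_modByMonic_lt p hmon (by
        intro h
        have := congrArg Polynomial.natDegree h
        simp at this)
      rw [Polynomial.natDegree_X_pow_sub_C] at this
      omega
    obtain ⟨d₁, d₀, hd⟩ := Polynomial.exists_eq_X_add_C_of_natDegree_le_one hdeg
    have hp : AdjoinRoot.mk (Polynomial.X ^ 2 - Polynomial.C g) p = d₀ • 1 +
        d₁ • AdjoinRoot.root (Polynomial.X ^ 2 - Polynomial.C g) := by
      conv_lhs => rw [← Polynomial.modByMonic_add_div p (Polynomial.X ^ 2 - Polynomial.C g), hd]
      simp [Algebra.smul_def, add_comm]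
    refine ⟨d₀ • a, d₁ • a, ?_⟩
    rw [hp, TensorProduct.add_tmul, TensorProduct.smul_tmul, TensorProduct.smul_tmul]

/-- If `g` is not a square in the division algebra `A`, then `A` stays a division algebra after
adjoining a square root of `g`. -/
lemma isUnit_adjoinRoot_tensor {E A : Type*} [Field E] [Ring A] [IsDomain A] [Algebra E A]
    [FiniteDimensional E A] {g : E} (hg : ∀ s : A, s * s ≠ algebraMap E A g)
    {u : AdjoinRoot (Polynomial.X ^ 2 - Polynomial.C g) ⊗[E] A} (hu : u ≠ 0) : IsUnit u := by
  set ρ := AdjoinRoot.root (Polynomial.X ^ 2 - Polynomial.C g) with hρ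
  have hρ2 : ρ * ρ = algebraMap E _ g := by
    have := AdjoinRoot.eval₂_root (Polynomial.X ^ 2 - Polynomial.C g)
    rw [Polynomial.eval₂_sub, Polynomial.eval₂_X_pow, Polynomial.eval₂_C, sub_eq_zero] at this
    exact (pow_two ρ).symm.trans this
  have hun (a : A) (ha : a ≠ 0) :
      IsUnit ((1 : AdjoinRoot (Polynomial.X ^ 2 - Polynomial.C g)) ⊗ₜ[E] a) :=
    (isUnit_of_finite_of_ne_zero E a ha).map
      (Algebra.TensorProduct.includeRight (R := E)
        (A := AdjoinRoot (Polynomial.X ^ 2 - Polynomial.C g)))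
  obtain ⟨α, β, rfl⟩ := exists_eq_add_root_tmul g u
  rw [← hρ] at hu ⊢
  by_cases hβ : β = 0
  · subst hβ
    rw [TensorProduct.tmul_zero, add_zero] at hu ⊢
    exact hun α fun h ↦ hu (by rw [h, TensorProduct.tmul_zero])
  · obtain ⟨v, hv⟩ := (isUnit_of_finite_of_ne_zero E β hβ).exists_right_inv
    set a := v * α with ha
    have hfac : (1 : AdjoinRoot (Polynomial.X ^ 2 - Polynomial.C g)) ⊗ₜ[E] α + ρ ⊗ₜ β =
        (1 ⊗ₜ β) * (1 ⊗ₜ a + ρ ⊗ₜ 1) := by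
      simp only [mul_add, Algebra.TensorProduct.tmul_mul_tmul, one_mul, mul_one, ha]
      rw [← mul_assoc, hv, one_mul]
    rw [hfac]
    refine (hun β hβ).mul ?_
    have hc : Commute ((1 : AdjoinRoot (Polynomial.X ^ 2 - Polynomial.C g)) ⊗ₜ[E] a + ρ ⊗ₜ 1)
        (1 ⊗ₜ a - ρ ⊗ₜ 1) := by
      have : Commute ((1 : AdjoinRoot (Polynomial.X ^ 2 - Polynomial.C g)) ⊗ₜ[E] a) (ρ ⊗ₜ 1) := by
        simp [Commute, SemiconjBy]
      exact ((Commute.refl _).sub_right this).add_left (this.symm.sub_right (Commute.refl _))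
    refine (hc.isUnit_mul_iff.1 ?_).1
    have : ((1 : AdjoinRoot (Polynomial.X ^ 2 - Polynomial.C g)) ⊗ₜ[E] a + ρ ⊗ₜ 1) *
        (1 ⊗ₜ a - ρ ⊗ₜ 1) = 1 ⊗ₜ (a * a - algebraMap E A g) := by
      simp only [add_mul, mul_sub, Algebra.TensorProduct.tmul_mul_tmul, one_mul, mul_one, hρ2,
        TensorProduct.tmul_sub, Algebra.algebraMap_eq_smul_one, TensorProduct.smul_tmul]
      abel
    rw [this]
    exact hun _ (sub_ne_zero.2 (hg a))

lemma irreducible_X_sq_sub_C {E A : Type*} [Field E] [Ring A] [Algebra E A] {g : E}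
    (hg : ∀ s : A, s * s ≠ algebraMap E A g) :
    Irreducible (Polynomial.X ^ 2 - Polynomial.C g) := by
  refine (Polynomial.Monic.irreducible_iff_roots_eq_zero_of_degree_le_three
    (Polynomial.monic_X_pow_sub_C g two_ne_zero) ?_ ?_).2 ?_
  · rw [Polynomial.natDegree_X_pow_sub_C]
  · rw [Polynomial.natDegree_X_pow_sub_C]
    norm_num
  · refine Multiset.eq_zero_of_forall_notMem fun r hr ↦ hg (algebraMap E A r) ?_
    have := Polynomial.isRoot_of_mem_roots hr
    rw [← map_mul, ← pow_two]
    congr 1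
    simpa [sub_eq_zero] using this

/-- The generic point of the quadric `X₀² = G(X₁, …, X_k)`. -/
lemma dvd_of_aeval_root_eq_zero {F E : Type*} [Field F] [Field E] [Algebra F E] {k : ℕ}
    (G : MvPolynomial (Fin k) F) {x : Fin k → E} (hx : AlgebraicIndependent F x)
    {p : MvPolynomial (Fin (k + 1)) F}
    (hp : aeval (Fin.cons (AdjoinRoot.root (Polynomial.X ^ 2 - Polynomial.C (aeval x G)))
      fun i ↦ algebraMap E _ (x i) :
        Fin (k + 1) → AdjoinRoot (Polynomial.X ^ 2 - Polynomial.C (aeval x G))) p = 0) :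
    X 0 ^ 2 - rename Fin.succ G ∣ p := by
  have key (q : MvPolynomial (Fin (k + 1)) F) :
      aeval (Fin.cons (AdjoinRoot.root (Polynomial.X ^ 2 - Polynomial.C (aeval x G)))
        fun i ↦ algebraMap E _ (x i) :
        Fin (k + 1) → AdjoinRoot (Polynomial.X ^ 2 - Polynomial.C (aeval x G))) q =
      AdjoinRoot.mk (Polynomial.X ^ 2 - Polynomial.C (aeval x G))
        ((finSuccEquiv F k q).map (aeval x : MvPolynomial (Fin k) F →ₐ[F] E).toRingHom) := by
    induction q using MvPolynomial.induction_on with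
    | C a =>
      simp [finSuccEquiv_apply]
      rfl
    | add p q hp hq => simp only [map_add, hp, hq, Polynomial.map_add]
    | mul_X p i hp =>
      rw [map_mul, hp, map_mul, Polynomial.map_mul, map_mul, aeval_X]
      refine Fin.cases ?_ (fun i ↦ ?_) i
      · simp [finSuccEquiv_X_zero]
      · simp [finSuccEquiv_X_succ]
  rw [key, AdjoinRoot.mk_eq_zero] at hp
  have h2 : Polynomial.X ^ 2 - Polynomial.C (aeval x G) = (Polynomial.X ^ 2 - Polynomial.C G).map
      (aeval x : MvPolynomial (Fin k) F →ₐ[F] E).toRingHom := by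
    simp
  rw [h2, Polynomial.map_dvd_map _ hx (Polynomial.monic_X_pow_sub_C G two_ne_zero)] at hp
  rw [← map_dvd_iff (finSuccEquiv F k)]
  have hG (H : MvPolynomial (Fin k) F) :
      finSuccEquiv F k (rename Fin.succ H) = Polynomial.C H := by
    induction H using MvPolynomial.induction_on with
    | C a => simp [finSuccEquiv_apply]
    | add p q hp hq => simp only [map_add, hp, hq]
    | mul_X p i hp => rw [map_mul, rename_X, map_mul, hp, finSuccEquiv_X_succ, ← map_mul]
  rwa [map_sub, map_pow, finSuccEquiv_X_zero, hG]

end QuadraticExtension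

section CliffordSum

lemma sum_sum_eq_zero_of_alternating {ι A : Type*} [Fintype ι] [AddCommGroup A] {c : ι → ι → A}
    (h₁ : ∀ i, c i i = 0) (h₂ : ∀ i j, c i j + c j i = 0) : ∑ i, ∑ j, c i j = 0 := by
  classical
  rw [← Finset.sum_product' Finset.univ Finset.univ]
  refine Finset.sum_involution (fun p _ ↦ p.swap) (fun p _ ↦ h₂ _ _) (fun p _ hp h ↦ hp ?_)
    (fun p _ ↦ Finset.mem_product.2 ⟨Finset.mem_univ _, Finset.mem_univ _⟩) (fun p _ ↦ p.swap_swap)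
  obtain ⟨i, j⟩ := p
  obtain rfl : j = i := congrArg Prod.fst h
  exact h₁ _

lemma CliffordRel.sum_smul_mul_self {R A κ : Type*} [CommRing R] [Ring A] [Algebra R A] [Fintype κ]
    {M : Matrix κ κ R} {z : κ → A} (hz : CliffordRel M z) (x : κ → R) :
    (∑ i, x i • z i) * ∑ i, x i • z i = algebraMap R A (∑ i, ∑ j, M i j * (x i * x j)) := by
  rw [← sub_eq_zero, Finset.sum_mul_sum, map_sum, ← Finset.sum_sub_distrib]
  simp_rw [map_sum, ← Finset.sum_sub_distrib]
  have h (i j : κ) : x i • z i * x j • z j - algebraMap R A (M i j * (x i * x j)) =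
      (x i * x j) • (z i * z j - algebraMap R A (M i j)) := by
    rw [smul_mul_smul_comm, smul_sub, map_mul, Algebra.commutes, ← Algebra.smul_def]
  simp_rw [h]
  refine sum_sum_eq_zero_of_alternating (fun i ↦ ?_) (fun i j ↦ ?_)
  · rw [hz.1, sub_self, smul_zero]
  · rw [mul_comm (x j), ← smul_add, sub_add_sub_comm, hz.2, map_add, sub_self, smul_zero]

variable {F : Type} [Field F] {n : ℕ} (ψ : QuadraticForm F (Fin n → F))

lemma toBilin'_coeffMat_self (v : Fin n → F) : Matrix.toBilin' (coeffMat F ψ) v v = ψ v := by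
  obtain ⟨B, rfl⟩ := LinearMap.BilinMap.toQuadraticMap_surjective ψ
  rw [LinearMap.BilinMap.toQuadraticMap_apply, ← sub_eq_zero]
  conv_lhs => rw [← LinearMap.BilinForm.toMatrix'_toBilin' (coeffMat F _)]
  nth_rewrite 2 [← Matrix.toBilin'_toMatrix' B]
  simp only [LinearMap.BilinForm.toMatrix'_toBilin', Matrix.toBilin'_apply,
    ← Finset.sum_sub_distrib]
  refine sum_sum_eq_zero_of_alternating (fun i ↦ ?_) (fun i j ↦ ?_)
  · simp [coeffMat, LinearMap.BilinForm.toMatrix'_apply]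
  · have h : coeffMat F B.toQuadraticMap i j + coeffMat F B.toQuadraticMap j i =
        LinearMap.BilinForm.toMatrix' B i j + LinearMap.BilinForm.toMatrix' B j i := by
      rcases lt_trichotomy i j with hij | rfl | hij
      · simp [coeffMat, LinearMap.BilinForm.toMatrix'_apply, hij, hij.ne, hij.ne', hij.not_gt,
          LinearMap.BilinMap.polar_toQuadraticMap]
      · simp [coeffMat, LinearMap.BilinForm.toMatrix'_apply]
      · simp [coeffMat, LinearMap.BilinForm.toMatrix'_apply, hij, hij.ne, hij.ne', hij.not_gt,
          LinearMap.BilinMap.polar_toQuadraticMap, add_comm]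
    linear_combination v i * v j * h

lemma toBilin'_coeffMat_add (v w : Fin n → F) :
    Matrix.toBilin' (coeffMat F ψ) v w + Matrix.toBilin' (coeffMat F ψ) w v = polar ψ v w := by
  simp only [polar, ← toBilin'_coeffMat_self ψ, map_add, LinearMap.add_apply]
  ring

end CliffordSum

section DivisionAlgebra

lemma isDivisionAlgebra_congr {S T : Type} [Ring S] [Ring T] (e : S ≃+* T) :
    IsDivisionAlgebra S ↔ IsDivisionAlgebra T := by
  have key {S T : Type} [Ring S] [Ring T] (e : S ≃+* T) (h : IsDivisionAlgebra S) :
      IsDivisionAlgebra T := by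
    refine ⟨fun h0 ↦ h.1 (e.injective (by simpa using h0)), fun x hx ↦ ?_⟩
    have := (h.2 (e.symm x) (by simpa using hx)).map e
    simpa using this
  exact ⟨key e, key e.symm⟩

lemma isDivisionAlgebra_tensor_of_injective {F D K K' : Type} [Field F] [Ring D] [Algebra F D]
    [FiniteDimensional F D] [Field K] [Algebra F K] [CommRing K'] [Algebra F K']
    (φ : K →ₐ[F] K') (hφ : Function.Injective φ) [IsDomain (K' ⊗[F] D)] :
    IsDivisionAlgebra (K ⊗[F] D) := by
  have : IsDomain (K ⊗[F] D) := by
    refine Function.Injective.isDomain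
      (Algebra.TensorProduct.map φ (AlgHom.id F D)).toRingHom ?_
    exact Module.Flat.rTensor_preserves_injective_linearMap φ.toLinearMap hφ
  exact ⟨zero_ne_one, fun x hx ↦ isUnit_of_finite_of_ne_zero K x hx⟩

lemma isDivisionAlgebra_tensor_funField {F D K' : Type} [Field F] [Ring D] [Algebra F D]
    [FiniteDimensional F D] [Field K'] [Algebra F K'] [IsDomain (K' ⊗[F] D)]
    {n : ℕ} (ψ : QuadraticForm F (Fin n → F)) (y : Fin n → K')
    (h0 : aeval y (qfPoly F ψ) = 0)
    (h : ∀ p : MvPolynomial (Fin n) F, aeval y p = 0 → qfPoly F ψ ∣ p) :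
    IsDivisionAlgebra (D ⊗[F] FunField F ψ) := by
  let φ₀ : (MvPolynomial (Fin n) F ⧸ Ideal.span {qfPoly F ψ}) →ₐ[F] K' :=
    Ideal.Quotient.liftₐ _ (aeval y) fun p hp ↦ by
      obtain ⟨q, rfl⟩ := Ideal.mem_span_singleton.1 hp
      rw [map_mul, h0, zero_mul]
  have hφ₀ : Function.Injective φ₀ := by
    refine (injective_iff_map_eq_zero _).2 fun p hp ↦ ?_
    obtain ⟨p, rfl⟩ := Ideal.Quotient.mk_surjective p
    exact Ideal.Quotient.eq_zero_iff_mem.2 (Ideal.mem_span_singleton.2 (h p hp))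
  have hdom : IsDomain (MvPolynomial (Fin n) F ⧸ Ideal.span {qfPoly F ψ}) :=
    hφ₀.isDomain φ₀.toRingHom
  let φ : FractionRing (MvPolynomial (Fin n) F ⧸ Ideal.span {qfPoly F ψ}) →ₐ[F] K' :=
    IsFractionRing.liftAlgHom hφ₀
  have := isDivisionAlgebra_tensor_of_injective (D := D) φ φ.toRingHom.injective
  exact (isDivisionAlgebra_congr (Algebra.TensorProduct.comm F D (FunField F ψ)).toRingEquiv).2 this

end DivisionAlgebra

section FunFieldCriterion

lemma exists_basis_zero_eq {F : Type*} [Field F] {k : ℕ} {e : Fin (k + 1) → F} (he : e ≠ 0) :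
    ∃ b : Module.Basis (Fin (k + 1)) F (Fin (k + 1) → F), b 0 = e := by
  obtain ⟨W, hW⟩ := Submodule.exists_isCompl (F ∙ e)
  have hfin : Module.finrank F W = k := by
    have := Submodule.finrank_add_eq_of_isCompl hW
    rw [finrank_span_singleton he, Module.finrank_fin_fun] at this
    omega
  refine ⟨Module.Basis.mkFinCons e (Module.finBasisOfFinrankEq F W hfin) (fun c x hx h ↦ ?_)
    fun z ↦ ?_, ?_⟩
  · have h2 : c • e ∈ (F ∙ e) ⊓ W := ⟨Submodule.smul_mem _ _ (Submodule.mem_span_singleton_self e),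
      by rw [eq_neg_of_add_eq_zero_left h]; exact W.neg_mem hx⟩
    rw [hW.inf_eq_bot, Submodule.mem_bot] at h2
    exact (smul_eq_zero.1 h2).resolve_right he
  · have hz : z ∈ (F ∙ e) ⊔ W := by rw [hW.sup_eq_top]; trivial
    obtain ⟨y, hy, w, hw, rfl⟩ := Submodule.mem_sup.1 hz
    obtain ⟨c, rfl⟩ := Submodule.mem_span_singleton.1 hy
    exact ⟨-c, by simpa using hw⟩
  · simp

variable {F : Type} [Field F]

/-- Linear change of variables attached to a basis. -/
noncomputable def changeVar {n : ℕ} (b : Module.Basis (Fin n) F (Fin n → F)) :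
    MvPolynomial (Fin n) F →ₐ[F] MvPolynomial (Fin n) F :=
  aeval fun l ↦ ∑ i, C (b i l) * X i

lemma exists_leftInverse_changeVar {n : ℕ} (b : Module.Basis (Fin n) F (Fin n → F)) :
    ∃ L : MvPolynomial (Fin n) F →ₐ[F] MvPolynomial (Fin n) F, ∀ p, L (changeVar b p) = p := by
  refine ⟨aeval fun i ↦ ∑ l, C (b.repr (Pi.single l 1) i) * X l, fun p ↦ ?_⟩
  rw [← AlgHom.comp_apply]
  conv_rhs => rw [← AlgHom.id_apply (R := F) p]
  congr 1
  refine MvPolynomial.algHom_ext fun l ↦ ?_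
  simp only [changeVar, AlgHom.comp_apply, aeval_X, map_sum, map_mul, AlgHom.id_apply, Finset.mul_sum,
    algHom_C, algebraMap_eq]
  rw [Finset.sum_comm]
  have h (l' : Fin n) : ∑ i, C (b i l) * (C (b.repr (Pi.single l' 1) i) * X l') =
      C ((Pi.single l' 1 : Fin n → F) l) * X l' := by
    conv_rhs => rw [← b.sum_repr (Pi.single l' 1)]
    simp only [Finset.sum_apply, Pi.smul_apply, smul_eq_mul, map_sum, map_mul, Finset.sum_mul]
    exact Finset.sum_congr rfl fun i _ ↦ by ring
  simp_rw [h]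
  rw [Finset.sum_eq_single l] <;> simp +contextual [eq_comm]

lemma changeVar_qfPoly {n : ℕ} (b : Module.Basis (Fin n) F (Fin n → F))
    (ψ : QuadraticForm F (Fin n → F)) :
    changeVar b (qfPoly F ψ) =
      ∑ i, ∑ j, C (Matrix.toBilin' (coeffMat F ψ) (b i) (b j)) * (X i * X j) := by
  simp only [changeVar, qfPoly, map_sum, map_mul, aeval_X, algHom_C, algebraMap_eq,
    Matrix.toBilin'_apply, Finset.sum_mul_sum]
  simp only [Finset.mul_sum, Finset.sum_mul]
  have h (f : Fin n → Fin n → Fin n → Fin n → MvPolynomial (Fin n) F) :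
      ∑ l, ∑ l', ∑ i, ∑ j, f l l' i j = ∑ i, ∑ j, ∑ l, ∑ l', f l l' i j := by
    simp_rw [← Finset.sum_product']
    refine Finset.sum_bij' (fun p _ ↦ ⟨p.2.2.1, p.2.2.2, p.1, p.2.1⟩)
      (fun p _ ↦ ⟨p.2.2.1, p.2.2.2, p.1, p.2.1⟩) ?_ ?_ ?_ ?_ ?_ <;> simp
  rw [h]
  refine Finset.sum_congr rfl fun i _ ↦ Finset.sum_congr rfl fun j _ ↦ Finset.sum_congr rfl
    fun l _ ↦ Finset.sum_congr rfl fun l' _ ↦ by ring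

lemma changeVar_qfPoly_eq [CharP F 2] {k : ℕ}
    (b : Module.Basis (Fin (k + 1)) F (Fin (k + 1) → F))
    (ψ : QuadraticForm F (Fin (k + 1) → F)) (he : ψ (b 0) = 1) (hpol : ∀ v, polar ψ (b 0) v = 0) :
    changeVar b (qfPoly F ψ) = X 0 ^ 2 - rename Fin.succ (∑ i : Fin k, ∑ j : Fin k,
      C (Matrix.toBilin' (coeffMat F ψ) (b i.succ) (b j.succ)) * (X i * X j)) := by
  rw [changeVar_qfPoly, CharTwo.sub_eq_add, Fin.sum_univ_succ]
  simp_rw [Fin.sum_univ_succ]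
  rw [toBilin'_coeffMat_self, he, Finset.sum_add_distrib]
  simp only [map_sum, map_mul, rename_X, rename_C, map_one]
  have h : ∑ i : Fin k, C (Matrix.toBilin' (coeffMat F ψ) (b 0) (b i.succ)) * (X 0 * X i.succ) +
      ∑ i : Fin k, C (Matrix.toBilin' (coeffMat F ψ) (b i.succ) (b 0)) * (X i.succ * X 0) =
        (0 : MvPolynomial (Fin (k + 1)) F) := by
    rw [← Finset.sum_add_distrib]
    refine Finset.sum_eq_zero fun i _ ↦ ?_
    rw [mul_comm (X i.succ), ← add_mul, ← map_add, toBilin'_coeffMat_add, hpol, map_zero, zero_mul]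
  linear_combination h

theorem exists_linearMap_of_not_isDivisionAlgebra [CharP F 2] {D : Type} [Ring D] [IsDomain D]
    [Algebra F D] [FiniteDimensional F D] {k : ℕ} (ψ : QuadraticForm F (Fin (k + 1) → F))
    {e : Fin (k + 1) → F} (he : ψ e = 1) (hpol : ∀ v, polar ψ e v = 0)
    (h : ¬ IsDivisionAlgebra (D ⊗[F] FunField F ψ)) :
    ∃ f : (Fin (k + 1) → F) →ₗ[F] D, f e = 1 ∧ ∀ v, f v * f v = algebraMap F D (ψ v) := by
  obtain ⟨b, rfl⟩ := exists_basis_zero_eq (e := e) (by rintro rfl; simp at he)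
  set B := Matrix.toBilin' (coeffMat F ψ) with hB
  obtain ⟨E, _, _, x, hx, hdom, hgen⟩ := exists_generic k F D
  set G : MvPolynomial (Fin k) F := ∑ i : Fin k, ∑ j : Fin k,
    C (B (b i.succ) (b j.succ)) * (X i * X j) with hG
  by_cases hs : ∃ s : E ⊗[F] D, s * s = algebraMap E _ (aeval x G)
  · obtain ⟨z, hz⟩ := hgen (Matrix.of fun i j ↦ if i = 0 ∨ j = 0 then 0 else B (b i) (b j)) (by
      obtain ⟨s, hs⟩ := hs
      refine ⟨s, hs.trans ?_⟩
      congr 1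
      simp [hG, Fin.sum_univ_succ])
    have hz' : CliffordRel (Matrix.of fun i j ↦ B (b i) (b j))
        (Fin.cons 1 fun i ↦ z i.succ : Fin (k + 1) → D) := by
      have hB0 (i : Fin k) : B (b 0) (b i.succ) + B (b i.succ) (b 0) = 0 := by
        rw [hB, toBilin'_coeffMat_add, hpol]
      have h2 : (2 : D) = 0 := by
        rw [← map_ofNat (algebraMap F D) 2, CharTwo.two_eq_zero, map_zero]
      refine ⟨Fin.cases ?_ fun i ↦ ?_, Fin.cases (Fin.cases ?_ fun j ↦ ?_) fun i ↦
        Fin.cases ?_ fun j ↦ ?_⟩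
      · simp [hB, toBilin'_coeffMat_self, he]
      · simpa using hz.1 i.succ
      · simp [hB, toBilin'_coeffMat_self, he]
      · have := hB0 j
        simp [Fin.cons_zero, this, ← two_mul, h2]
      · have := hB0 i
        rw [add_comm] at this
        simp [Fin.cons_zero, this, ← two_mul, h2]
      · simpa using hz.2 i.succ j.succ
    refine ⟨b.constr F (Fin.cons 1 fun i ↦ z i.succ : Fin (k + 1) → D), ?_, fun v ↦ ?_⟩
    · rw [Module.Basis.constr_basis, Fin.cons_zero]
    · rw [Module.Basis.constr_apply_fintype, hz'.sum_smul_mul_self, ← toBilin'_coeffMat_self ψ v, ← hB]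
      congr 1
      conv_rhs => rw [← b.sum_repr v]
      simp only [map_sum, LinearMap.sum_apply, map_smul, LinearMap.smul_apply, smul_eq_mul,
        Matrix.of_apply, Module.Basis.equivFun_apply]
      rw [Finset.sum_comm]
      refine Finset.sum_congr rfl fun i _ ↦ ?_
      rw [Finset.mul_sum]
      exact Finset.sum_congr rfl fun j _ ↦ by ring
  · push Not at hs
    refine absurd ?_ h
    have : Fact (Irreducible (Polynomial.X ^ 2 - Polynomial.C (aeval x G))) :=
      ⟨irreducible_X_sq_sub_C hs⟩
    have hK : IsDomain (AdjoinRoot (Polynomial.X ^ 2 - Polynomial.C (aeval x G)) ⊗[F] D) := by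
      let ε := cancelBaseChangeRing F E (AdjoinRoot (Polynomial.X ^ 2 - Polynomial.C (aeval x G))) D
      have hnt : Nontrivial
          (AdjoinRoot (Polynomial.X ^ 2 - Polynomial.C (aeval x G)) ⊗[F] D) := inferInstance
      refine (isDomain_iff_noZeroDivisors_and_nontrivial _).2 ⟨⟨fun {u v} huv ↦ ?_⟩, hnt⟩
      by_cases hu : u = 0
      · exact Or.inl hu
      · have := (isUnit_adjoinRoot_tensor hs (u := ε.symm u) (by simpa using hu)).map ε
        rw [AlgEquiv.apply_symm_apply] at this
        exact Or.inr (this.mul_right_eq_zero.1 huv)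
    set Y : Fin (k + 1) → AdjoinRoot (Polynomial.X ^ 2 - Polynomial.C (aeval x G)) :=
      Fin.cons (AdjoinRoot.root (Polynomial.X ^ 2 - Polynomial.C (aeval x G)))
        fun i ↦ algebraMap E _ (x i) with hY
    have hY' (p : MvPolynomial (Fin (k + 1)) F) :
        aeval (fun l ↦ aeval Y (∑ i, C (b i l) * X i)) p = aeval Y (changeVar b p) := by
      rw [changeVar, ← AlgHom.comp_apply, comp_aeval]
    have hqf := changeVar_qfPoly_eq b ψ he hpol
    refine isDivisionAlgebra_tensor_funField
      (K' := AdjoinRoot (Polynomial.X ^ 2 - Polynomial.C (aeval x G))) ψ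
      (fun l ↦ aeval Y (∑ i, C (b i l) * X i)) ?_ fun p hp ↦ ?_
    · rw [hY', hqf, map_sub, map_pow, aeval_X, aeval_rename, ← hB, ← hG, hY, Fin.cons_zero]
      have : Fin.cons (AdjoinRoot.root (Polynomial.X ^ 2 - Polynomial.C (aeval x G)))
          (fun i ↦ algebraMap E _ (x i)) ∘ Fin.succ = fun i ↦ algebraMap E
            (AdjoinRoot (Polynomial.X ^ 2 - Polynomial.C (aeval x G))) (x i) := rfl
      rw [this]
      refine (congrArg _ (aeval_algebraMap_apply _ x G)).trans ?_
      have := AdjoinRoot.eval₂_root (Polynomial.X ^ 2 - Polynomial.C (aeval x G))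
      rwa [Polynomial.eval₂_sub, Polynomial.eval₂_X_pow, Polynomial.eval₂_C] at this
    · rw [hY'] at hp
      obtain ⟨L, hL⟩ := exists_leftInverse_changeVar b
      have := map_dvd L (dvd_of_aeval_root_eq_zero G hx hp)
      rwa [← hqf, hL, hL] at this

end FunFieldCriterion

section FunFieldConverse

variable {F : Type} [Field F]

instance {n : ℕ} (ψ : QuadraticForm F (Fin n → F)) :
    IsScalarTower F (FunFieldRing F ψ) (FunField F ψ) :=
  inferInstanceAs (IsScalarTower F (FunFieldRing F ψ) (FractionRing (FunFieldRing F ψ)))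

/-- The projection onto the coordinate ring of the quadric. -/
noncomputable def funFieldMk {n : ℕ} (ψ : QuadraticForm F (Fin n → F)) :
    MvPolynomial (Fin n) F →ₐ[F] FunFieldRing F ψ :=
  Ideal.Quotient.mkₐ F (Ideal.span {qfPoly F ψ})

/-- The coordinate functions on the quadric. -/
noncomputable def funFieldX {n : ℕ} (ψ : QuadraticForm F (Fin n → F)) (l : Fin n) : FunField F ψ :=
  algebraMap (FunFieldRing F ψ) _ (funFieldMk ψ (X l))

lemma aeval_funFieldX {n : ℕ} (ψ : QuadraticForm F (Fin n → F)) (p : MvPolynomial (Fin n) F) :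
    aeval (funFieldX ψ) p = algebraMap (FunFieldRing F ψ) _ (funFieldMk ψ p) := by
  have : aeval (funFieldX ψ) =
      (IsScalarTower.toAlgHom F (FunFieldRing F ψ) (FunField F ψ)).comp (funFieldMk ψ) := by
    refine MvPolynomial.algHom_ext fun l ↦ ?_
    rw [aeval_X]
    rfl
  rw [this]
  rfl

lemma aeval_funFieldX_eq_zero_iff {n : ℕ} (ψ : QuadraticForm F (Fin n → F))
    (p : MvPolynomial (Fin n) F) : aeval (funFieldX ψ) p = 0 ↔ qfPoly F ψ ∣ p := by
  have : Function.Injective (algebraMap (FunFieldRing F ψ) (FunField F ψ)) :=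
    IsLocalization.injective (M := nonZeroDivisors (MvPolynomial (Fin n) F ⧸ Ideal.span {qfPoly F ψ}))
      (FractionRing (MvPolynomial (Fin n) F ⧸ Ideal.span {qfPoly F ψ})) le_rfl
  rw [aeval_funFieldX, map_eq_zero_iff _ this, ← Ideal.mem_span_singleton]
  exact Ideal.Quotient.eq_zero_iff_mem

lemma funFieldX_ne_zero {n : ℕ} {ψ : QuadraticForm F (Fin n → F)} (hψ : ψ.Anisotropic)
    (l : Fin n) : funFieldX ψ l ≠ 0 := by
  intro h
  rw [← aeval_X (R := F) (funFieldX ψ) l, aeval_funFieldX_eq_zero_iff] at h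
  have h2 := map_dvd (aeval (Pi.single l Polynomial.X : Fin n → Polynomial F)) h
  have h3 : aeval (Pi.single l Polynomial.X : Fin n → Polynomial F) (qfPoly F ψ) =
      Polynomial.C (ψ (Pi.single l 1)) * (Polynomial.X * Polynomial.X) := by
    simp only [qfPoly, map_sum, map_mul, aeval_X, algHom_C]
    rw [Finset.sum_eq_single l, Finset.sum_eq_single l]
    · simp [coeffMat]
    · intro j _ hj
      simp [hj]
    · simp
    · intro i _ hi
      simp [hi]
    · simp
  have h4 : ψ (Pi.single l 1) ≠ 0 := fun h0 ↦ by
    have := congrFun (hψ _ h0) l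
    simp at this
  rw [h3, aeval_X, Pi.single_eq_same] at h2
  have h5 := Polynomial.natDegree_le_of_dvd h2 Polynomial.X_ne_zero
  rw [Polynomial.natDegree_C_mul h4, Polynomial.natDegree_X_mul Polynomial.X_ne_zero,
    Polynomial.natDegree_X] at h5
  omega

theorem not_isDivisionAlgebra_of_linearMap {D : Type} [Ring D] [Nontrivial D] [Algebra F D]
    {k : ℕ} {ψ : QuadraticForm F (Fin (k + 1) → F)} (hψ : ψ.Anisotropic)
    (f : (Fin (k + 1) → F) →ₗ[F] D) (hf : ∀ v, f v * f v = algebraMap F D (ψ v)) :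
    ¬ IsDivisionAlgebra (D ⊗[F] FunField F ψ) := by
  rw [isDivisionAlgebra_congr (Algebra.TensorProduct.comm F D (FunField F ψ)).toRingEquiv]
  intro h
  set e : Fin (k + 1) → Fin (k + 1) → F := fun l ↦ Pi.single l 1
  have hpol (v w) : f v * f w + f w * f v = algebraMap F D (polar ψ v w) := by
    rw [polar, map_sub, map_sub, ← hf, ← hf, ← hf, map_add]
    noncomm_ring
  have hrel : CliffordRel ((coeffMat F ψ).map (algebraMap F (FunField F ψ)))
      fun l ↦ (1 : FunField F ψ) ⊗ₜ[F] f (e l) := by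
    have hB (i j) : coeffMat F ψ i j = Matrix.toBilin' (coeffMat F ψ) (e i) (e j) := by
      simp [e]
    have ht (a : F) : (1 : FunField F ψ) ⊗ₜ[F] algebraMap F D a =
        algebraMap (FunField F ψ) _ (algebraMap F (FunField F ψ) a) := by
      rw [← IsScalarTower.algebraMap_apply, Algebra.TensorProduct.algebraMap_apply,
        Algebra.algebraMap_eq_smul_one, Algebra.algebraMap_eq_smul_one, TensorProduct.smul_tmul]
    refine ⟨fun i ↦ ?_, fun i j ↦ ?_⟩
    · rw [Algebra.TensorProduct.tmul_mul_tmul, one_mul, hf, ht, Matrix.map_apply, hB,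
        toBilin'_coeffMat_self]
    · rw [Algebra.TensorProduct.tmul_mul_tmul, Algebra.TensorProduct.tmul_mul_tmul, one_mul,
        ← TensorProduct.tmul_add, hpol, ht, Matrix.map_apply, Matrix.map_apply, ← map_add, hB, hB,
        toBilin'_coeffMat_add]
  have hsq := hrel.sum_smul_mul_self (funFieldX ψ)
  have h0 : ∑ i, ∑ j, ((coeffMat F ψ).map (algebraMap F (FunField F ψ))) i j *
      (funFieldX ψ i * funFieldX ψ j) = 0 := by
    rw [← (aeval_funFieldX_eq_zero_iff ψ (qfPoly F ψ)).2 dvd_rfl]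
    simp [qfPoly]
  rw [h0, map_zero] at hsq
  have hζ : ∑ l, funFieldX ψ l • (1 : FunField F ψ) ⊗ₜ[F] f (e l) = 0 := by
    by_contra hne
    exact hne ((h.2 _ hne).mul_left_eq_zero.1 hsq)
  have hinj : LinearMap.ker f = ⊥ := by
    refine LinearMap.ker_eq_bot'.2 fun v hv ↦ hψ v ?_
    have := hf v
    rw [hv, zero_mul, eq_comm, map_eq_zero_iff _ (algebraMap F D).injective] at this
    exact this
  obtain ⟨g, hg⟩ := f.exists_leftInverse_of_injective hinj
  have hg' (v) : g (f v) = v := LinearMap.congr_fun hg v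
  have := congrArg (TensorProduct.rid F (FunField F ψ) ∘
    LinearMap.lTensor (FunField F ψ) (LinearMap.proj 0 ∘ₗ g)) hζ
  simp only [Function.comp_apply, map_sum, TensorProduct.smul_tmul', smul_eq_mul, mul_one,
    LinearMap.lTensor_tmul, LinearMap.comp_apply, hg', LinearMap.proj_apply, TensorProduct.rid_tmul,
    map_zero] at this
  rw [Finset.sum_eq_single 0] at this
  · exact funFieldX_ne_zero hψ 0 (by simpa [e] using this)
  · intro l _ hl
    simp [e, hl.symm]
  · simp

end FunFieldConverse

section Quaternion

variable {F D : Type} [Field F] [Ring D] [Algebra F D]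

/-- `I` and `J` generate pairwise commuting quaternion algebras `[βₖ, αₖ)`. -/
structure QuatGens {n : ℕ} (α β : Fin n → F) (I J : Fin n → D) : Prop where
  sq_left : ∀ k, I k * I k + I k = algebraMap F D (β k)
  sq_right : ∀ k, J k * J k = algebraMap F D (α k)
  swap : ∀ k, J k * I k = I k * J k + J k
  comm_left : ∀ k l, k ≠ l → Commute (I k) (I l)
  comm_mixed : ∀ k l, k ≠ l → Commute (I k) (J l)
  comm_right : ∀ k l, k ≠ l → Commute (J k) (J l)

/-- The standard basis `1, i, j, ij` of a quaternion algebra. -/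
def quatBasis (i j : D) : Fin 4 → D := ![1, i, j, i * j]

lemma quatBasis_commute {i j x : D} (hi : Commute x i) (hj : Commute x j) (t : Fin 4) :
    Commute x (quatBasis i j t) := by
  fin_cases t
  · exact Commute.one_right x
  · exact hi
  · exact hj
  · exact hi.mul_right hj

lemma eq_zero_of_sum_quatBasis_mul [IsDomain D] {i j : D} (hj : j ≠ 0)
    (hij : j * i = i * j + j) {r : Fin 4 → D} (hri : ∀ t, Commute i (r t))
    (hrj : ∀ t, Commute j (r t)) (h : ∑ t, quatBasis i j t * r t = 0) (t : Fin 4) : r t = 0 := by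
  simp only [Fin.sum_univ_four, quatBasis, Matrix.cons_val, one_mul] at h
  have c1 : j * (r 0 + i * r 1 + j * r 2 + i * j * r 3) -
      (r 0 + i * r 1 + j * r 2 + i * j * r 3) * j = j * (r 1 + j * r 3) := by
    have e0 := (hrj 0).eq
    have e1 := (hrj 1).eq
    have e2 := (hrj 2).eq
    have e3 := (hrj 3).eq
    have a1 : j * (i * r 1) - i * r 1 * j = j * r 1 := by
      rw [mul_assoc i, ← e1, ← mul_assoc, hij, add_mul, mul_assoc]; abel
    have a3 : j * (i * j * r 3) - i * j * r 3 * j = j * (j * r 3) := by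
      rw [mul_assoc (i * j), ← e3, ← mul_assoc, ← mul_assoc, hij]; noncomm_ring
    rw [mul_add j (r 1), ← a1, ← a3]
    have a0 : j * r 0 - r 0 * j = 0 := by rw [e0, sub_self]
    have a2 : j * (j * r 2) - j * r 2 * j = 0 := by rw [mul_assoc j, ← e2, sub_self]
    have := congrArg₂ (· + ·) a0 a2
    simp only [add_zero] at this
    rw [← sub_eq_zero, ← this]
    noncomm_ring
  rw [h, mul_zero, zero_mul, sub_zero, eq_comm] at c1
  have d1 := (mul_eq_zero.1 c1).resolve_left hj
  have h3 : r 3 = 0 := by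
    have : i * (r 1 + j * r 3) - (r 1 + j * r 3) * i = - (j * r 3) := by
      rw [mul_add, add_mul, (hri 1).eq, mul_assoc j, ← (hri 3).eq, ← mul_assoc j, hij]
      noncomm_ring
    rw [d1, mul_zero, zero_mul, sub_zero, eq_comm, neg_eq_zero] at this
    exact (mul_eq_zero.1 this).resolve_left hj
  have h1 : r 1 = 0 := by simpa [h3] using d1
  have h2 : r 2 = 0 := by
    have h' : r 0 + j * r 2 = 0 := by simpa [h1, h3] using h
    have : i * (r 0 + j * r 2) - (r 0 + j * r 2) * i = - (j * r 2) := by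
      rw [mul_add, add_mul, (hri 0).eq, mul_assoc j, ← (hri 2).eq, ← mul_assoc j, hij]
      noncomm_ring
    rw [h', mul_zero, zero_mul, sub_zero, eq_comm, neg_eq_zero] at this
    exact (mul_eq_zero.1 this).resolve_left hj
  have h0 : r 0 = 0 := by simpa [h1, h2, h3] using h
  fin_cases t <;> assumption

lemma QuatGens.tail {n : ℕ} {α β : Fin (n + 1) → F} {I J : Fin (n + 1) → D}
    (h : QuatGens α β I J) : QuatGens (fun k ↦ α k.succ) (fun k ↦ β k.succ) (fun k ↦ I k.succ)
      (fun k ↦ J k.succ) where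
  sq_left _ := h.sq_left _
  sq_right _ := h.sq_right _
  swap _ := h.swap _
  comm_left _ _ hkl := h.comm_left _ _ fun h ↦ hkl (Fin.succ_injective _ h)
  comm_mixed _ _ hkl := h.comm_mixed _ _ fun h ↦ hkl (Fin.succ_injective _ h)
  comm_right _ _ hkl := h.comm_right _ _ fun h ↦ hkl (Fin.succ_injective _ h)

lemma Commute.list_ofFn_prod {n : ℕ} {x : D} {f : Fin n → D} (h : ∀ k, Commute x (f k)) :
    Commute x (List.ofFn f).prod := by
  refine Commute.list_prod_right _ _ fun y hy ↦ ?_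
  obtain ⟨k, rfl⟩ := (List.mem_ofFn' _ _).1 hy
  exact h k

/-- The monomials in the generators of commuting quaternion algebras are linearly independent
over their centralizer. -/
lemma QuatGens.eq_zero_of_sum [IsDomain D] : ∀ {n : ℕ} {α β : Fin n → F} {I J : Fin n → D},
    QuatGens α β I J → (∀ k, α k ≠ 0) → ∀ {r : (Fin n → Fin 4) → D},
    (∀ k t, Commute (I k) (r t)) → (∀ k t, Commute (J k) (r t)) →
    ∑ t, (List.ofFn fun k ↦ quatBasis (I k) (J k) (t k)).prod * r t = 0 → ∀ t, r t = 0
  | 0, α, β, I, J, _, _, r, _, _, hr => fun t ↦ by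
    simp at hr
    exact (congrArg r (Subsingleton.elim t _)).trans hr
  | n + 1, α, β, I, J, hg, hα, r, hI, hJ, hr => fun t ↦ by
    rw [← (Fin.consEquiv fun _ ↦ Fin 4).sum_comp, Fintype.sum_prod_type] at hr
    simp only [Fin.consEquiv_apply, List.ofFn_succ, Fin.cons_zero, Fin.cons_succ, List.prod_cons,
      mul_assoc, ← Finset.mul_sum] at hr
    have hJ0 : J 0 ≠ 0 := fun h0 ↦ hα 0 (by
      have := hg.sq_right 0
      rwa [h0, mul_zero, eq_comm, map_eq_zero_iff _ (algebraMap F D).injective] at this)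
    have key := eq_zero_of_sum_quatBasis_mul hJ0 (hg.swap 0) (fun s ↦ ?_) (fun s ↦ ?_) hr
    · have := hg.tail.eq_zero_of_sum (fun k ↦ hα _) (r := fun t' ↦ r (Fin.cons (t 0) t'))
        (fun k t' ↦ hI _ _) (fun k t' ↦ hJ _ _) (key (t 0)) (Fin.tail t)
      rwa [Fin.cons_self_tail] at this
    · refine Commute.sum_right _ _ _ fun t' _ ↦ (Commute.list_ofFn_prod fun k ↦ ?_).mul_right (hI _ _)
      exact quatBasis_commute (hg.comm_left _ _ (Fin.succ_ne_zero k).symm)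
        (hg.comm_mixed _ _ (Fin.succ_ne_zero k).symm) _
    · refine Commute.sum_right _ _ _ fun t' _ ↦ (Commute.list_ofFn_prod fun k ↦ ?_).mul_right (hJ _ _)
      exact quatBasis_commute (hg.comm_mixed _ _ (Fin.succ_ne_zero k)).symm
        (hg.comm_right _ _ (Fin.succ_ne_zero k).symm) _

end Quaternion

section QuatAlg

variable {F D : Type} [Field F] [Ring D] [Algebra F D]

/-- The generators of `QuatAlg`. -/
noncomputable def quatGen (F : Type) [Field F] (β α : F) (s : Fin 2) : QuatAlg F β α :=
  RingQuot.mkAlgHom F (QuatRel F β α) (FreeAlgebra.ι F s)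

lemma quatGen_sq_left (β α : F) : quatGen F β α 0 * quatGen F β α 0 + quatGen F β α 0 =
    algebraMap F _ β := by
  have := RingQuot.mkAlgHom_rel F (QuatRel.i_sq (a := β) (b := α))
  rw [map_add, map_mul, AlgHom.commutes] at this
  exact this

lemma quatGen_sq_right (β α : F) : quatGen F β α 1 * quatGen F β α 1 = algebraMap F _ α := by
  have := RingQuot.mkAlgHom_rel F (QuatRel.j_sq (a := β) (b := α))
  rw [map_mul, AlgHom.commutes] at this
  exact this

lemma quatGen_swap (β α : F) : quatGen F β α 1 * quatGen F β α 0 =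
    quatGen F β α 0 * quatGen F β α 1 + quatGen F β α 1 := by
  have := RingQuot.mkAlgHom_rel F (QuatRel.swap (a := β) (b := α))
  rw [map_add, map_mul, map_mul] at this
  exact this

lemma QuatAlg.induction {β α : F} {p : QuatAlg F β α → Prop}
    (h0 : ∀ r, p (algebraMap F _ r)) (h1 : ∀ s, p (quatGen F β α s))
    (hm : ∀ x y, p x → p y → p (x * y)) (ha : ∀ x y, p x → p y → p (x + y)) (x) : p x := by
  obtain ⟨x, rfl⟩ := RingQuot.mkAlgHom_surjective F (QuatRel F β α) x
  induction x with
  | grade0 r => rw [AlgHom.commutes]; exact h0 r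
  | grade1 s => exact h1 s
  | mul x y hx hy => rw [map_mul]; exact hm _ _ hx hy
  | add x y hx hy => rw [map_add]; exact ha _ _ hx hy

lemma QuatAlg.span_quatBasis (β α : F) :
    Submodule.span F (Set.range (quatBasis (quatGen F β α 0) (quatGen F β α 1))) = ⊤ := by
  set i := quatGen F β α 0
  set j := quatGen F β α 1
  set S := Submodule.span F (Set.range (quatBasis i j))
  have m (t : Fin 4) : quatBasis i j t ∈ S := Submodule.subset_span ⟨t, rfl⟩
  have m0 : 1 ∈ S := m 0
  have m1 : i ∈ S := m 1
  have m2 : j ∈ S := m 2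
  have m3 : i * j ∈ S := m 3
  have hii : i * i = β • 1 - i := by
    rw [← Algebra.algebraMap_eq_smul_one, ← quatGen_sq_left]
    exact (add_sub_cancel_right _ _).symm
  have hjj : j * j = α • 1 := by
    rw [← Algebra.algebraMap_eq_smul_one, ← quatGen_sq_right]
  have hji : j * i = i * j + j := quatGen_swap β α
  have stab {g : QuatAlg F β α} (hg : ∀ t, g * quatBasis i j t ∈ S) {y} (hy : y ∈ S) :
      g * y ∈ S := by
    refine (Submodule.span_le (p := S.comap (LinearMap.mulLeft F g))).2 ?_ hy
    rintro _ ⟨t, rfl⟩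
    exact hg t
  have key (x : QuatAlg F β α) : ∀ y ∈ S, x * y ∈ S := by
    induction x using QuatAlg.induction with
    | h0 r => intro y hy; rw [← Algebra.smul_def]; exact S.smul_mem _ hy
    | h1 s =>
      intro y hy
      refine stab (fun t ↦ ?_) hy
      fin_cases s <;> fin_cases t
      · change i * 1 ∈ S
        rwa [mul_one]
      · change i * i ∈ S
        rw [hii]
        exact S.sub_mem (S.smul_mem _ m0) m1
      · exact m3
      · change i * (i * j) ∈ S
        rw [← mul_assoc, hii, sub_mul, smul_mul_assoc, one_mul]
        exact S.sub_mem (S.smul_mem _ m2) m3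
      · change j * 1 ∈ S
        rwa [mul_one]
      · change j * i ∈ S
        rw [hji]
        exact S.add_mem m3 m2
      · change j * j ∈ S
        rw [hjj]
        exact S.smul_mem _ m0
      · change j * (i * j) ∈ S
        rw [← mul_assoc, hji, add_mul, mul_assoc, hjj, mul_smul_comm, mul_one]
        exact S.add_mem (S.smul_mem _ m1) (S.smul_mem _ m0)
    | hm a b hx hy => intro z hz; rw [mul_assoc]; exact hx _ (hy _ hz)
    | ha a b hx hy => intro z hz; rw [add_mul]; exact S.add_mem (hx _ hz) (hy _ hz)
  rw [eq_top_iff]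
  intro x _
  have := key x 1 m0
  rwa [mul_one] at this

/-- The homomorphism out of `QuatAlg` determined by the images of the generators. -/
noncomputable def quatLift {β α : F} (i j : D) (hi : i * i + i = algebraMap F D β)
    (hj : j * j = algebraMap F D α) (hji : j * i = i * j + j) : QuatAlg F β α →ₐ[F] D :=
  RingQuot.liftAlgHom F ⟨FreeAlgebra.lift F ![i, j], by
    intro x y h
    cases h <;> simp [*]⟩

lemma quatLift_quatGen {β α : F} {i j : D} (hi : i * i + i = algebraMap F D β)
    (hj : j * j = algebraMap F D α) (hji : j * i = i * j + j) (s : Fin 2) :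
    quatLift i j hi hj hji (quatGen F β α s) = ![i, j] s := by
  have := RingQuot.liftAlgHom_mkAlgHom_apply F (FreeAlgebra.lift F ![i, j])
    (s := QuatRel F β α) (by
    intro x y h
    cases h <;> simp [*]) (FreeAlgebra.ι F s)
  exact this.trans (FreeAlgebra.lift_ι_apply _ _)

lemma quatLift_quatBasis {β α : F} {i j : D} (hi : i * i + i = algebraMap F D β)
    (hj : j * j = algebraMap F D α) (hji : j * i = i * j + j) (t : Fin 4) :
    quatLift i j hi hj hji (quatBasis (quatGen F β α 0) (quatGen F β α 1) t) =
      quatBasis i j t := by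
  have h0 := quatLift_quatGen hi hj hji 0
  have h1 := quatLift_quatGen hi hj hji 1
  fin_cases t
  · exact map_one _
  · exact h0
  · exact h1
  · exact (map_mul _ _ _).trans (congrArg₂ _ h0 h1)

lemma commute_quatLift {β α : F} {i j x : D} (hi : i * i + i = algebraMap F D β)
    (hj : j * j = algebraMap F D α) (hji : j * i = i * j + j) (hxi : Commute x i)
    (hxj : Commute x j) (q : QuatAlg F β α) : Commute x (quatLift i j hi hj hji q) := by
  induction q using QuatAlg.induction with
  | h0 r => rw [AlgHom.commutes]; exact (Algebra.commutes r x).symm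
  | h1 s =>
    rw [quatLift_quatGen]
    fin_cases s
    exacts [hxi, hxj]
  | hm a b ha hb => rw [map_mul]; exact ha.mul_right hb
  | ha a b ha hb => rw [map_add]; exact ha.add_right hb

end QuatAlg

section Sqrt

variable {F : Type} [Field F]

lemma exists_algHom_of_sqrt_mem {B : Type} [Field B] [Algebra F B] [FiniteDimensional F B]
    [CharP F 2] {m : ℕ} {c : Fin m → F} (s : Fin m → B)
    (hs : ∀ l, s l * s l = algebraMap F B (c l)) : Nonempty (sqrtExt F c →ₐ[F] B) := by
  let τ : B →ₐ[F] AlgebraicClosure F := IsAlgClosed.lift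
  have hle : sqrtExt F c ≤ τ.fieldRange := by
    refine IntermediateField.adjoin_le_iff.2 ?_
    rintro y ⟨l, hl⟩
    have : CharP (AlgebraicClosure F) 2 := charP_of_injective_algebraMap (algebraMap F _).injective 2
    refine ⟨s l, CharTwo.sq_injective ?_⟩
    change τ (s l) ^ 2 = y ^ 2
    rw [hl, pow_two, ← map_mul, hs, AlgHom.commutes]
  exact ⟨((AlgEquiv.ofInjectiveField τ).symm : τ.range →ₐ[F] B).comp
    (IntermediateField.inclusion hle)⟩

lemma exists_sqrtExt_algHom [CharP F 2] {D : Type} [Ring D] [IsDomain D] [Algebra F D]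
    [FiniteDimensional F D] {m : ℕ} {c : Fin m → F} {s : Fin m → D}
    (hs : ∀ l, s l * s l = algebraMap F D (c l)) (hc : ∀ l l', Commute (s l) (s l')) :
    ∃ g : sqrtExt F c →ₐ[F] D, ∀ x, g x ∈ Algebra.adjoin F (Set.range s) := by
  have hcomm : ∀ x ∈ Set.range s, ∀ y ∈ Set.range s, x * y = y * x := by
    rintro _ ⟨l, rfl⟩ _ ⟨l', rfl⟩
    exact hc l l'
  have hfield : IsField (Algebra.adjoin F (Set.range s)) :=
    { exists_pair_ne := ⟨0, 1, zero_ne_one⟩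
      mul_comm := (Algebra.isMulCommutative_adjoin F hcomm).is_comm.comm
      mul_inv_cancel := fun {a} ha ↦ (isUnit_of_finite_of_ne_zero F a ha).exists_right_inv }
  let _ := hfield.toField
  obtain ⟨g⟩ := exists_algHom_of_sqrt_mem (B := Algebra.adjoin F (Set.range s)) (c := c)
    (fun l ↦ ⟨s l, Algebra.subset_adjoin ⟨l, rfl⟩⟩) fun l ↦ Subtype.ext (hs l)
  exact ⟨(Algebra.adjoin F (Set.range s)).val.comp g, fun x ↦ (g x).2⟩

/-- The square root of `c l` in `sqrtExt F c`. -/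
lemma exists_sqrtExt_mul_self {m : ℕ} (c : Fin m → F) (l : Fin m) :
    ∃ y : sqrtExt F c, y * y = algebraMap F _ (c l) := by
  obtain ⟨y, hy⟩ := IsAlgClosed.exists_pow_nat_eq (algebraMap F (AlgebraicClosure F) (c l))
    two_pos
  refine ⟨⟨y, IntermediateField.subset_adjoin _ _ ⟨l, hy⟩⟩, Subtype.ext ?_⟩
  exact (pow_two y).symm.trans hy

end Sqrt

section PiTensor

variable {F D : Type} [Field F] [Ring D] [Algebra F D]

lemma list_ofFn_mul_prod : ∀ {n : ℕ} {x y : Fin n → D}, (∀ k l, k ≠ l → Commute (y k) (x l)) →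
    (List.ofFn (x * y)).prod = (List.ofFn x).prod * (List.ofFn y).prod
  | 0, _, _, _ => by simp
  | n + 1, x, y, h => by
    have ih := list_ofFn_mul_prod (x := fun k ↦ x (Fin.succ k)) (y := fun k ↦ y (Fin.succ k))
      fun k l hkl ↦ h _ _ fun h' ↦ hkl (Fin.succ_injective _ h')
    have h0 : Commute (y 0) (List.ofFn fun k ↦ x (Fin.succ k)).prod :=
      Commute.list_ofFn_prod fun k ↦ h _ _ (Fin.succ_ne_zero k).symm
    rw [List.ofFn_succ, List.ofFn_succ, List.ofFn_succ (f := y), List.prod_cons, List.prod_cons,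
      List.prod_cons]
    have : (fun i : Fin n ↦ (x * y) i.succ) = (fun k ↦ x (Fin.succ k)) * fun k ↦ y (Fin.succ k) := rfl
    rw [this, ih, Pi.mul_apply, mul_assoc, mul_assoc, ← mul_assoc (y 0), h0.eq, mul_assoc]

/-- The homomorphism from a tensor product of algebras given by homomorphisms with pairwise
commuting images. -/
noncomputable def piTensorLift {n : ℕ} {A : Fin n → Type} [∀ k, Ring (A k)] [∀ k, Algebra F (A k)]
    (q : ∀ k, A k →ₐ[F] D) (h : ∀ k l, k ≠ l → ∀ x y, Commute (q k x) (q l y)) :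
    (⨂[F] k, A k) →ₐ[F] D :=
  PiTensorProduct.liftAlgHom
    ((MultilinearMap.mkPiAlgebraFin F n D).compLinearMap fun k ↦ (q k).toLinearMap)
    (by
      simp only [MultilinearMap.compLinearMap_apply, MultilinearMap.mkPiAlgebraFin_apply]
      refine List.prod_eq_one fun z hz ↦ ?_
      obtain ⟨k, rfl⟩ := (List.mem_ofFn' _ _).1 hz
      exact map_one (q k))
    fun x y ↦ by
      simp only [MultilinearMap.compLinearMap_apply, MultilinearMap.mkPiAlgebraFin_apply]
      refine Eq.trans ?_ (list_ofFn_mul_prod (x := fun k ↦ q k (x k)) (y := fun k ↦ q k (y k))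
        fun k l hkl ↦ h k l hkl _ _)
      congr 2
      ext k
      exact map_mul (q k) _ _

lemma piTensorLift_tprod {n : ℕ} {A : Fin n → Type} [∀ k, Ring (A k)] [∀ k, Algebra F (A k)]
    (q : ∀ k, A k →ₐ[F] D) (h : ∀ k l, k ≠ l → ∀ x y, Commute (q k x) (q l y)) (x : ∀ k, A k) :
    piTensorLift q h (PiTensorProduct.tprod F x) = (List.ofFn fun k ↦ q k (x k)).prod := by
  exact PiTensorProduct.lift.tprod
    (φ := (MultilinearMap.mkPiAlgebraFin F n D).compLinearMap fun k ↦ (q k).toLinearMap) x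

lemma exists_eq_sum_tprod_quatBasis {n : ℕ} (α β : Fin n → F) {R : Type} [Ring R] [Algebra F R]
    (u : (⨂[F] k, QuatAlg F (β k) (α k)) ⊗[F] R) :
    ∃ r : (Fin n → Fin 4) → R, u = ∑ t, (PiTensorProduct.tprod F fun k ↦
      quatBasis (quatGen F (β k) (α k) 0) (quatGen F (β k) (α k) 1) (t k)) ⊗ₜ r t := by
  induction u using TensorProduct.induction_on with
  | zero => exact ⟨0, by simp⟩
  | add u v hu hv =>
    obtain ⟨r, rfl⟩ := hu
    obtain ⟨r', rfl⟩ := hv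
    exact ⟨r + r', by simp [TensorProduct.tmul_add, Finset.sum_add_distrib]⟩
  | tmul p y =>
    induction p using PiTensorProduct.induction_on with
    | smul_tprod a x =>
      have hx (k) : ∃ d : Fin 4 → F, ∑ t, d t • quatBasis (quatGen F (β k) (α k) 0)
          (quatGen F (β k) (α k) 1) t = x k := by
        refine (Submodule.mem_span_range_iff_exists_fun F).1 ?_
        rw [QuatAlg.span_quatBasis]
        trivial
      choose d hd using hx
      refine ⟨fun t ↦ (a * ∏ k, d k (t k)) • y, ?_⟩
      have : x = fun k ↦ ∑ t, d k t • quatBasis (quatGen F (β k) (α k) 0)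
          (quatGen F (β k) (α k) 1) t := funext fun k ↦ (hd k).symm
      rw [this, MultilinearMap.map_sum, Finset.smul_sum, TensorProduct.sum_tmul]
      refine Finset.sum_congr rfl fun t _ ↦ ?_
      rw [MultilinearMap.map_smul_univ, smul_smul, TensorProduct.smul_tmul]
    | add p p' hp hp' =>
      obtain ⟨r, hr⟩ := hp
      obtain ⟨r', hr'⟩ := hp'
      exact ⟨r + r', by
        rw [TensorProduct.add_tmul, hr, hr']
        simp [TensorProduct.tmul_add, Finset.sum_add_distrib]⟩

end PiTensor

section Generators

variable {F D : Type} [Field F] [Ring D] [Algebra F D]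

/-- `I`, `J`, `S` satisfy the relations of the standard generators of
`[β₁, α₁) ⊗ ⋯ ⊗ [βₙ, αₙ) ⊗ F(√c₁, …, √cₘ)`. -/
structure StdGens {n m : ℕ} (α β : Fin n → F) (c : Fin m → F) (I J : Fin n → D) (S : Fin m → D) :
    Prop extends QuatGens α β I J where
  sq_sqrt : ∀ l, S l * S l = algebraMap F D (c l)
  comm_sqrt : ∀ l l', Commute (S l) (S l')
  comm_sqrt_left : ∀ l k, Commute (S l) (I k)
  comm_sqrt_right : ∀ l k, Commute (S l) (J k)

theorem StdGens.exists_subalgebra [CharP F 2] [IsDomain D] [FiniteDimensional F D] {n m : ℕ}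
    {α β : Fin n → F} {c : Fin m → F} {I J : Fin n → D} {S : Fin m → D}
    (h : StdGens α β c I J S) (hα : ∀ k, α k ≠ 0) :
    ∃ A : Subalgebra F D, Nonempty
      (↥A ≃ₐ[F] ((⨂[F] k : Fin n, QuatAlg F (β k) (α k)) ⊗[F] ↥(sqrtExt F c))) := by
  obtain ⟨g, hg⟩ := exists_sqrtExt_algHom h.sq_sqrt h.comm_sqrt
  let q (k) := quatLift (I k) (J k) (h.sq_left k) (h.sq_right k) (h.swap k)
  have hq (k l) (hkl : k ≠ l) (x y) : Commute (q k x) (q l y) := by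
    refine commute_quatLift _ _ _ (Commute.symm ?_) (Commute.symm ?_) y
    · exact commute_quatLift _ _ _ (h.comm_left _ _ hkl.symm) (h.comm_mixed _ _ hkl.symm) x
    · exact commute_quatLift _ _ _ (h.comm_mixed _ _ hkl).symm (h.comm_right _ _ hkl.symm) x
  have hgc {x : D} (hx : ∀ l, Commute (S l) x) (y) : Commute x (g y) := by
    have : Algebra.adjoin F (Set.range S) ≤ Subalgebra.centralizer F {x} := by
      refine Algebra.adjoin_le ?_
      rintro _ ⟨l, rfl⟩
      rw [SetLike.mem_coe, Subalgebra.mem_centralizer_iff]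
      rintro _ rfl
      exact (hx l).symm
    exact Subalgebra.mem_centralizer_iff F |>.1 (this (hg y)) x rfl
  have hpg (p : ⨂[F] k, QuatAlg F (β k) (α k)) (y) : Commute (piTensorLift q hq p) (g y) := by
    induction p using PiTensorProduct.induction_on with
    | smul_tprod a x =>
      rw [map_smul, piTensorLift_tprod]
      refine Commute.smul_left (Commute.symm (Commute.list_ofFn_prod fun k ↦ ?_)) a
      exact commute_quatLift _ _ _ (hgc (fun l ↦ h.comm_sqrt_left l k) y).symm
        (hgc (fun l ↦ h.comm_sqrt_right l k) y).symm _
    | add p p' hp hp' => rw [map_add]; exact hp.add_left hp'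
  let Φ := Algebra.TensorProduct.lift (piTensorLift q hq) g hpg
  have hΦ : Function.Injective Φ := by
    refine (injective_iff_map_eq_zero _).2 fun u hu ↦ ?_
    obtain ⟨r, rfl⟩ := exists_eq_sum_tprod_quatBasis α β u
    simp only [Φ, map_sum, Algebra.TensorProduct.lift_tmul, piTensorLift_tprod, q,
      quatLift_quatBasis] at hu
    have := h.toQuatGens.eq_zero_of_sum hα (r := fun t ↦ g (r t))
      (fun k t ↦ hgc (fun l ↦ h.comm_sqrt_left l k) _)
      (fun k t ↦ hgc (fun l ↦ h.comm_sqrt_right l k) _) hu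
    refine Finset.sum_eq_zero fun t _ ↦ ?_
    rw [(map_eq_zero_iff g g.toRingHom.injective).1 (this t), TensorProduct.tmul_zero]
  exact ⟨Φ.range, ⟨(AlgEquiv.ofInjective Φ hΦ).symm⟩⟩

theorem exists_stdGens {n m : ℕ} {α β : Fin n → F} {c : Fin m → F}
    (φ : ((⨂[F] k : Fin n, QuatAlg F (β k) (α k)) ⊗[F] ↥(sqrtExt F c)) →ₐ[F] D) :
    ∃ (I J : Fin n → D) (S : Fin m → D), StdGens α β c I J S := by
  choose y hy using exists_sqrtExt_mul_self c
  let ι (k : Fin n) : QuatAlg F (β k) (α k) →ₐ[F] D :=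
    (φ.comp Algebra.TensorProduct.includeLeft).comp
      (PiTensorProduct.singleAlgHom (A := fun k ↦ QuatAlg F (β k) (α k)) k)
  let σ : sqrtExt F c →ₐ[F] D := φ.comp Algebra.TensorProduct.includeRight
  have hιι (k l) (hkl : k ≠ l) (x y) : Commute (ι k x) (ι l y) := by
    refine Commute.map ?_ (φ.comp Algebra.TensorProduct.includeLeft)
    exact Commute.tprod
      (Pi.mulSingle_commute (f := fun k ↦ QuatAlg F (β k) (α k)) hkl x y)
  have hσι (k x z) : Commute (σ z) (ι k x) := by
    refine Commute.map ?_ φ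
    simp [Commute, SemiconjBy]
  refine ⟨fun k ↦ ι k (quatGen F _ _ 0), fun k ↦ ι k (quatGen F _ _ 1), fun l ↦ σ (y l),
    ⟨fun k ↦ ?_, fun k ↦ ?_, fun k ↦ ?_, fun k l hkl ↦ hιι k l hkl _ _,
      fun k l hkl ↦ hιι k l hkl _ _, fun k l hkl ↦ hιι k l hkl _ _⟩, fun l ↦ ?_, fun l l' ↦ ?_,
      fun l k ↦ hσι _ _ _, fun l k ↦ hσι _ _ _⟩
  · rw [← map_mul, ← map_add, quatGen_sq_left, AlgHom.commutes]
  · rw [← map_mul, quatGen_sq_right, AlgHom.commutes]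
  · rw [← map_mul, ← map_mul, ← map_add, quatGen_swap]
  · rw [← map_mul, hy, AlgHom.commutes]
  · exact (Commute.all _ _).map σ

end Generators

section StandardForm

variable {F D : Type} [Field F] [Ring D] [Algebra F D]

/-- The quadratic form `α₁[1, β₁] ⊥ ⋯ ⊥ αₙ[1, βₙ] ⊥ ⟨1, c₁, …, cₘ⟩`. -/
noncomputable def stdQF {n m : ℕ} (α β : Fin n → F) (c : Fin m → F) :
    QuadraticForm F ((Fin n → Fin 2 → F) × (Fin (m + 1) → F)) :=
  (QuadraticMap.pi fun i : Fin n => α i • binQF 1 (β i)).prod (diagQF (Matrix.vecCons 1 c))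

lemma stdQF_apply {n m : ℕ} (α β : Fin n → F) (c : Fin m → F) (p : Fin n → Fin 2 → F)
    (r : Fin (m + 1) → F) : stdQF α β c (p, r) =
      ∑ k, α k * (p k 0 * p k 0 + p k 0 * p k 1 + β k * (p k 1 * p k 1)) +
        (r 0 * r 0 + ∑ l, c l * (r l.succ * r l.succ)) := by
  simp only [stdQF, QuadraticMap.prod_apply, QuadraticMap.pi_apply, diagQF,
    QuadraticMap.weightedSumSquares_apply, Fin.sum_univ_succ, Matrix.cons_val_zero,
    Matrix.cons_val_succ, smul_eq_mul, one_mul, _root_.smul_apply]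
  congr 1
  refine Finset.sum_congr rfl fun k _ ↦ ?_
  congr 1
  change LinearMap.BilinMap.toQuadraticMap (Matrix.toLinearMap₂' F !![1, 1; 0, β k]) (p k) = _
  rw [LinearMap.BilinMap.toQuadraticMap_apply]
  simp [Matrix.toLinearMap₂'_apply, Fin.sum_univ_two]
  ring

lemma stdQF_polar [CharP F 2] {n m : ℕ} (α β : Fin n → F) (c : Fin m → F)
    (p p' : Fin n → Fin 2 → F) (r r' : Fin (m + 1) → F) :
    polar (stdQF α β c) (p, r) (p', r') = ∑ k, α k * (p k 0 * p' k 1 + p k 1 * p' k 0) := by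
  have h2 : (2 : F) = 0 := CharTwo.two_eq_zero
  rw [polar, Prod.mk_add_mk, stdQF_apply, stdQF_apply, stdQF_apply]
  have h1 : ∑ k, α k * ((p + p') k 0 * (p + p') k 0 + (p + p') k 0 * (p + p') k 1 +
      β k * ((p + p') k 1 * (p + p') k 1)) =
      ∑ k, α k * (p k 0 * p k 0 + p k 0 * p k 1 + β k * (p k 1 * p k 1)) +
      ∑ k, α k * (p' k 0 * p' k 0 + p' k 0 * p' k 1 + β k * (p' k 1 * p' k 1)) +
      ∑ k, α k * (p k 0 * p' k 1 + p k 1 * p' k 0) := by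
    rw [← Finset.sum_add_distrib, ← Finset.sum_add_distrib]
    refine Finset.sum_congr rfl fun k _ ↦ ?_
    simp only [Pi.add_apply]
    linear_combination (α k * (p k 0 * p' k 0) + α k * β k * (p k 1 * p' k 1)) * h2
  have h3 : ∑ l, c l * ((r + r') (Fin.succ l) * (r + r') (Fin.succ l)) =
      ∑ l, c l * (r l.succ * r l.succ) + ∑ l, c l * (r' l.succ * r' l.succ) := by
    rw [← Finset.sum_add_distrib]
    refine Finset.sum_congr rfl fun k _ ↦ ?_
    simp only [Pi.add_apply]
    linear_combination c k * (r k.succ * r' k.succ) * h2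
  rw [h1, h3]
  simp only [Pi.add_apply]
  linear_combination r 0 * r' 0 * h2

lemma sum_mul_self_of_commute [CharP F 2] {ι : Type} [Fintype ι] {z : ι → D}
    (h : ∀ i j, i ≠ j → Commute (z i) (z j)) : (∑ i, z i) * ∑ i, z i = ∑ i, z i * z i := by
  classical
  have h2 : (2 : D) = 0 := by
    rw [← map_ofNat (algebraMap F D) 2, CharTwo.two_eq_zero, map_zero]
  have h3 : ∑ i, z i * z i = ∑ i, ∑ j, if i = j then z i * z j else 0 := by simp
  rw [Finset.sum_mul_sum, ← sub_eq_zero, h3]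
  simp_rw [← Finset.sum_sub_distrib]
  refine sum_sum_eq_zero_of_alternating (fun i ↦ by simp) fun i j ↦ ?_
  by_cases hij : i = j
  · simp [hij]
  · simp [hij, Ne.symm hij, (h i j hij).eq, ← two_mul, h2]

theorem StdGens.exists_linearMap [CharP F 2] {n m : ℕ} {α β : Fin n → F} {c : Fin m → F}
    {I J : Fin n → D} {S : Fin m → D} (h : StdGens α β c I J S) :
    ∃ f : ((Fin n → Fin 2 → F) × (Fin (m + 1) → F)) →ₗ[F] D,
      ∀ v, f v * f v = algebraMap F D (stdQF α β c v) := by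
  have h2 : (2 : D) = 0 := by
    rw [← map_ofNat (algebraMap F D) 2, CharTwo.two_eq_zero, map_zero]
  let A (k) (x : Fin 2 → F) : D := x 0 • J k + x 1 • (I k * J k)
  let B : Fin (m + 1) → D := Fin.cons 1 S
  have hA (k x) : A k x * A k x =
      algebraMap F D (α k * (x 0 * x 0 + x 0 * x 1 + β k * (x 1 * x 1))) := by
    have h1 : I k * J k * (I k * J k) = algebraMap F D (β k * α k) := by
      rw [map_mul, ← h.sq_left, ← h.sq_right, mul_assoc, ← mul_assoc (J k), h.swap]
      noncomm_ring
    have h3 : J k * (I k * J k) + I k * J k * J k = algebraMap F D (α k) := by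
      rw [← mul_assoc, h.swap, ← h.sq_right]
      have : I k * J k * J k + I k * J k * J k = 0 := by rw [← two_mul, h2, zero_mul]
      rw [add_mul, add_right_comm, this, zero_add]
    have h4 : A k x * A k x = (x 0 * x 0) • (J k * J k) +
        (x 0 * x 1) • (J k * (I k * J k) + I k * J k * J k) +
        (x 1 * x 1) • (I k * J k * (I k * J k)) := by
      simp only [A, add_mul, mul_add, smul_mul_smul_comm, smul_add, mul_comm (x 1) (x 0)]
      abel
    rw [h4, h1, h3, h.sq_right]
    simp only [Algebra.smul_def, ← map_mul, ← map_add]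
    congr 1
    ring
  have hAA (k l) (hkl : k ≠ l) (x y) : Commute (A k x) (A l y) := by
    have h1 := h.comm_right k l hkl
    have h3 : Commute (I k) (I l * J l) := (h.comm_left k l hkl).mul_right (h.comm_mixed k l hkl)
    have h4 : Commute (J k) (I l * J l) := (h.comm_mixed l k hkl.symm).symm.mul_right h1
    have h5 : Commute (I k * J k) (J l) := (h.comm_mixed k l hkl).mul_left h1
    have h6 : Commute (I k * J k) (I l * J l) := h3.mul_left h4
    exact (((h1.smul_right _).add_right (h4.smul_right _)).smul_left _).add_left
      (((h5.smul_right _).add_right (h6.smul_right _)).smul_left _)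
  have hBB (l l') : Commute (B l) (B l') := by
    refine Fin.cases (Commute.one_left _) (fun l ↦ ?_) l
    exact Fin.cases (Commute.one_right _) (fun l' ↦ h.comm_sqrt _ _) l'
  have hBA (l k x) : Commute (B l) (A k x) := by
    refine Fin.cases (Commute.one_left _) (fun l ↦ ?_) l
    exact ((h.comm_sqrt_right l k).smul_right _).add_right
      (((h.comm_sqrt_left l k).mul_right (h.comm_sqrt_right l k)).smul_right _)
  let f : ((Fin n → Fin 2 → F) × (Fin (m + 1) → F)) →ₗ[F] D :=
    { toFun := fun v ↦ ∑ s : Fin n ⊕ Fin (m + 1), Sum.elim (fun k ↦ A k (v.1 k)) (fun l ↦ v.2 l • B l) s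
      map_add' := fun v w ↦ by
        rw [← Finset.sum_add_distrib]
        refine Finset.sum_congr rfl ?_
        rintro (k | l) -
        · simp only [Sum.elim_inl, A, Prod.fst_add, Pi.add_apply, add_smul]
          abel
        · simp only [Sum.elim_inr, Prod.snd_add, Pi.add_apply, add_smul]
      map_smul' := fun a v ↦ by
        rw [Finset.smul_sum]
        refine Finset.sum_congr rfl ?_
        rintro (k | l) -
        · simp [A, smul_smul]
        · simp [smul_smul] }
  refine ⟨f, fun v ↦ ?_⟩
  change (∑ s : Fin n ⊕ Fin (m + 1), Sum.elim (fun k ↦ A k (v.1 k)) (fun l ↦ v.2 l • B l) s) *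
    (∑ s : Fin n ⊕ Fin (m + 1), Sum.elim (fun k ↦ A k (v.1 k)) (fun l ↦ v.2 l • B l) s) = _
  rw [sum_mul_self_of_commute (F := F)]
  · obtain ⟨p, r⟩ := v
    rw [stdQF_apply, Fintype.sum_sum_type, map_add, map_sum]
    congr 1
    · exact Finset.sum_congr rfl fun k _ ↦ hA _ _
    · simp only [Sum.elim_inr, smul_mul_smul_comm, Fin.sum_univ_succ, map_add, map_sum, B,
        Fin.cons_zero, Fin.cons_succ, mul_one, h.sq_sqrt]
      simp [Algebra.smul_def, Algebra.commutes]
  · rintro (k | l) (k' | l') hne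
    · exact hAA _ _ (fun h ↦ hne (congrArg _ h)) _ _
    · exact ((hBA _ _ _).smul_left _).symm
    · exact (hBA _ _ _).smul_left _
    · exact ((hBB _ _).smul_left _).smul_right _

theorem exists_stdGens_of_linearMap [CharP F 2] {n m : ℕ} {α β : Fin n → F} {c : Fin m → F}
    (hα : ∀ k, α k ≠ 0) (f : ((Fin n → Fin 2 → F) × (Fin (m + 1) → F)) →ₗ[F] D)
    (hf : ∀ v, f v * f v = algebraMap F D (stdQF α β c v)) :
    ∃ (I J : Fin n → D) (S : Fin m → D), StdGens α β c I J S := by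
  have h2 : (2 : D) = 0 := by
    rw [← map_ofNat (algebraMap F D) 2, CharTwo.two_eq_zero, map_zero]
  have hd (x : D) : x + x = 0 := by rw [← two_mul, h2, zero_mul]
  have hpol (v w) : f v * f w + f w * f v = algebraMap F D (polar (stdQF α β c) v w) := by
    rw [polar, map_sub, map_sub, ← hf, ← hf, ← hf, map_add]
    noncomm_ring
  have hcomm {v w} (h : polar (stdQF α β c) v w = 0) : Commute (f v) (f w) := by
    have h1 := hpol v w
    rw [h, map_zero] at h1
    have h3 := hd (f w * f v)
    exact add_right_cancel (h1.trans h3.symm)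
  let J (k) : D := f (Pi.single k (Pi.single 0 1), 0)
  let T (k) : D := f (Pi.single k (Pi.single 1 1), 0)
  let S (l : Fin m) : D := f (0, Pi.single l.succ 1)
  have hJ (k) : J k * J k = algebraMap F D (α k) := by
    rw [hf, stdQF_apply, Finset.sum_eq_single k] <;> simp +contextual
  have hT (k) : T k * T k = algebraMap F D (α k * β k) := by
    rw [hf, stdQF_apply, Finset.sum_eq_single k] <;> simp +contextual
  have hS (l) : S l * S l = algebraMap F D (c l) := by
    rw [hf, stdQF_apply]
    congr 1
    simp only [Pi.zero_apply, mul_zero, add_zero, Finset.sum_const_zero, zero_add]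
    rw [Finset.sum_eq_single l] <;> simp +contextual
  have hTJ (k) : J k * T k = T k * J k + algebraMap F D (α k) := by
    have : J k * T k + T k * J k = algebraMap F D (α k) := by
      rw [hpol, stdQF_polar, Finset.sum_eq_single k] <;> simp +contextual
    rw [← this, add_left_comm, hd, add_zero]
  have c1 (k l) (hkl : k ≠ l) (x y : Fin 2 → F) :
      polar (stdQF α β c) (Pi.single k x, 0) (Pi.single l y, 0) = 0 := by
    rw [stdQF_polar]
    refine Finset.sum_eq_zero fun i _ ↦ ?_
    by_cases hi : i = k
    · subst hi
      simp [hkl]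
    · simp [hi]
  have c2 (r : Fin (m + 1) → F) (v) : polar (stdQF α β c) (0, r) v = 0 := by
    obtain ⟨p, r'⟩ := v
    rw [stdQF_polar]
    simp
  have hcJ (k l) (hkl : k ≠ l) : Commute (J k) (J l) := hcomm (c1 k l hkl _ _)
  have hcT (k l) (hkl : k ≠ l) : Commute (T k) (T l) := hcomm (c1 k l hkl _ _)
  have hcTJ (k l) (hkl : k ≠ l) : Commute (T k) (J l) := hcomm (c1 k l hkl _ _)
  have hinv (k) : algebraMap F D (α k) = α k • (1 : D) := Algebra.algebraMap_eq_smul_one _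
  refine ⟨fun k ↦ (α k)⁻¹ • (T k * J k), J, S, ⟨fun k ↦ ?_, hJ, fun k ↦ ?_, fun k l hkl ↦ ?_,
    fun k l hkl ↦ ?_, hcJ⟩, hS, fun l l' ↦ hcomm (c2 _ _),
    fun l k ↦ ((hcomm (c2 _ _)).mul_right (hcomm (c2 _ _))).smul_right _, fun l k ↦ hcomm (c2 _ _)⟩
  · have h3 : T k * J k * (T k * J k) = (α k * (α k * β k)) • 1 + α k • (T k * J k) := by
      rw [mul_assoc, ← mul_assoc (J k), hTJ, add_mul, mul_add, mul_assoc (T k), hJ, ← mul_assoc, hT,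
        ← map_mul, hinv, Algebra.algebraMap_eq_smul_one, smul_mul_assoc, one_mul, mul_smul_comm,
        mul_comm (α k * β k)]
    simp only [smul_mul_smul_comm, h3, smul_add, smul_smul, add_assoc]
    have h4 : (α k)⁻¹ * (α k)⁻¹ * α k = (α k)⁻¹ := by
      rw [mul_assoc, inv_mul_cancel₀ (hα k), mul_one]
    have h5 : (α k)⁻¹ * (α k)⁻¹ * (α k * (α k * β k)) = β k := by
      field_simp [hα k]
    rw [h4, h5, hd, add_zero, Algebra.algebraMap_eq_smul_one]
  · simp only [mul_smul_comm, smul_mul_assoc]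
    rw [← mul_assoc, hTJ, add_mul, smul_add, hinv, smul_mul_assoc, one_mul, smul_smul,
      inv_mul_cancel₀ (hα k), one_smul]
  · exact ((((hcT k l hkl).mul_right (hcTJ k l hkl)).mul_left
      ((hcTJ l k hkl.symm).symm.mul_right (hcJ k l hkl))).smul_left _).smul_right _
  · exact ((hcTJ k l hkl).mul_left (hcJ k l hkl)).smul_left _

end StandardForm

theorem stmt16 (F : Type) [Field F] [CharP F 2]
    (D : Type) [DivisionRing D] [Algebra F D] [FiniteDimensional F D]
    (hcentral : Subalgebra.center F D = ⊥)
    (nn m : ℕ) (hdim : 2 ≤ 2 * nn + m + 1)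
    (a b : Fin nn → F) (c : Fin m → F)
    (ψ : QuadraticForm F (Fin (2 * nn + m + 1) → F)) (hψa : ψ.Anisotropic)
    (hψ : ψ.Equivalent ((QuadraticMap.pi fun i : Fin nn => a i • binQF 1 (b i)).prod
      (diagQF (Matrix.vecCons 1 c)))) :
    (¬ IsDivisionAlgebra (D ⊗[F] FunField F ψ) ↔
      ∃ A : Subalgebra F D, Nonempty (↥A ≃ₐ[F]
        ((⨂[F] i : Fin nn, QuatAlg F (b i) (a i)) ⊗[F] ↥(sqrtExt F c)))) := by
  obtain ⟨e⟩ := hψ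
  have he (v) : stdQF a b c (e v) = ψ v := e.map_app v
  have hes (v) : ψ (e.symm v) = stdQF a b c v := e.symm.map_app v
  have ha (k) : a k ≠ 0 := fun hk ↦ by
    have h1 : ψ (e.symm (Pi.single k (Pi.single 0 1), 0)) = 0 := by
      rw [hes, stdQF_apply]
      simp only [Pi.zero_apply, mul_zero, add_zero, Finset.sum_const_zero]
      refine Finset.sum_eq_zero fun l _ ↦ ?_
      by_cases hl : l = k
      · rw [hl, hk, zero_mul]
      · simp [hl]
    have h2 := hψa _ h1
    have h3 : ((Pi.single k (Pi.single 0 1), 0) : (Fin nn → Fin 2 → F) × (Fin (m + 1) → F)) = 0 :=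
      e.symm.toLinearEquiv.map_eq_zero_iff.mp h2
    simpa using congrFun (congrFun (congrArg Prod.fst h3) k) 0
  constructor
  · intro h
    have h1 : ψ (e.symm (0, Pi.single 0 1)) = 1 := by
      rw [hes, stdQF_apply]
      simp
    have h2 (v) : polar ψ (e.symm (0, Pi.single 0 1)) v = 0 := by
      have h3 : polar ψ (e.symm (0, Pi.single 0 1)) v =
          polar (stdQF a b c) (0, Pi.single 0 1) (e v) := by
        rw [polar, polar, ← he, ← he, ← he v, map_add]
        simp only [QuadraticMap.IsometryEquiv.apply_symm_apply]
      obtain ⟨p, r⟩ := e v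
      rw [h3, stdQF_polar]
      simp
    obtain ⟨f, -, hf⟩ := exists_linearMap_of_not_isDivisionAlgebra ψ h1 h2 h
    obtain ⟨I, J, S, hS⟩ := exists_stdGens_of_linearMap (α := a) (β := b) (c := c) ha
      (f ∘ₗ e.symm.toLinearEquiv.toLinearMap) fun v ↦ (hf _).trans (congrArg _ (hes v))
    exact hS.exists_subalgebra ha
  · rintro ⟨A, ⟨g⟩⟩
    obtain ⟨I, J, S, hS⟩ := exists_stdGens (A.val.comp g.symm.toAlgHom)
    obtain ⟨f, hf⟩ := hS.exists_linearMap
    exact not_isDivisionAlgebra_of_linearMap hψa (f ∘ₗ e.toLinearEquiv.toLinearMap)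
      fun v ↦ (hf _).trans (congrArg _ (he v))
end

section
/- Let F be a field of characteristic 2, let a,x ∈ F*, b,c ∈ F*, and let φ = a[1,x] ⊥ ⟨1,b,c⟩ be an anisotropic quadratic form over F. Then φ is a Pfister neighbour if and only if the algebra [x,a) ⊗_F F(√b,√c) is split, i.e. isomorphic to the 2×2 matrix algebra over the field F(√b,√c) obtained from F by adjoining square roots of b and c. -/
open QuadraticMap MvPolynomial
open scoped TensorProduct

set_option synthInstance.maxHeartbeats 1000000
set_option maxHeartbeats 1000000


section PfisterForms

variable {R : Type} [CommRing R]

theorem binQF_apply (a b : R) (v : Fin 2 → R) :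
    binQF a b v = a * v 0 ^ 2 + v 0 * v 1 + b * v 1 ^ 2 := by
  change LinearMap.BilinMap.toQuadraticMap (Matrix.toLinearMap₂' R !![a, 1; 0, b]) v = _
  simp [Matrix.toLinearMap₂'_apply, Fin.sum_univ_two]
  ring

theorem diagQF_three_apply (a b c : R) (v : Fin 3 → R) :
    diagQF ![a, b, c] v = a * v 0 ^ 2 + b * v 1 ^ 2 + c * v 2 ^ 2 := by
  simp [diagQF, QuadraticMap.weightedSumSquares_apply, Fin.sum_univ_three]
  ring

theorem univ_finset_fin_two :
    (Finset.univ : Finset (Finset (Fin 2))) = {∅, {0}, {1}, {0, 1}} := by decide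

theorem pfisterQF_two_apply (a : Fin 2 → R) (d : R) (v : Finset (Fin 2) → Fin 2 → R) :
    pfisterQF 2 a d v =
      (v ∅ 0 ^ 2 + v ∅ 0 * v ∅ 1 + d * v ∅ 1 ^ 2)
      + a 0 * (v {0} 0 ^ 2 + v {0} 0 * v {0} 1 + d * v {0} 1 ^ 2)
      + a 1 * (v {1} 0 ^ 2 + v {1} 0 * v {1} 1 + d * v {1} 1 ^ 2)
      + a 0 * a 1 * (v {0, 1} 0 ^ 2 + v {0, 1} 0 * v {0, 1} 1 + d * v {0, 1} 1 ^ 2) := by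
  have h1 : (∅ : Finset (Fin 2)) ∉ ({{0}, {1}, {0, 1}} : Finset (Finset (Fin 2))) := by decide
  have h2 : ({0} : Finset (Fin 2)) ∉ ({{1}, {0, 1}} : Finset (Finset (Fin 2))) := by decide
  have h3 : ({1} : Finset (Fin 2)) ∉ ({{0, 1}} : Finset (Finset (Fin 2))) := by decide
  simp only [pfisterQF, QuadraticMap.pi_apply, univ_finset_fin_two, Finset.sum_insert h1,
    Finset.sum_insert h2, Finset.sum_insert h3, Finset.sum_singleton, smul_apply,
    binQF_apply, smul_eq_mul, Finset.prod_empty, Finset.prod_singleton]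
  rw [Finset.prod_pair (by decide)]
  ring

theorem polarBilin_pfisterQF_nondegenerate {F : Type} [Field F] [CharP F 2] (a : Fin 2 → Fˣ)
    (d : F) : (polarBilin (pfisterQF 2 (fun i => (a i : F)) d)).Nondegenerate := by
  have h2 : (2 : F) = 0 := CharTwo.two_eq_zero
  have key : ∀ v w : Finset (Fin 2) → Fin 2 → F,
      polar (pfisterQF 2 (fun i => (a i : F)) d) v w =
        (v ∅ 0 * w ∅ 1 + v ∅ 1 * w ∅ 0) + a 0 * (v {0} 0 * w {0} 1 + v {0} 1 * w {0} 0)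
        + a 1 * (v {1} 0 * w {1} 1 + v {1} 1 * w {1} 0)
        + a 0 * a 1 * (v {0, 1} 0 * w {0, 1} 1 + v {0, 1} 1 * w {0, 1} 0) := by
    intro v w
    simp only [polar, pfisterQF_two_apply, Pi.add_apply]
    linear_combination ((v ∅ 0 * w ∅ 0 + d * v ∅ 1 * w ∅ 1)
      + a 0 * (v {0} 0 * w {0} 0 + d * v {0} 1 * w {0} 1)
      + a 1 * (v {1} 0 * w {1} 0 + d * v {1} 1 * w {1} 1)
      + a 0 * a 1 * (v {0, 1} 0 * w {0, 1} 0 + d * v {0, 1} 1 * w {0, 1} 1)) * h2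
  rw [LinearMap.IsRefl.nondegenerate_iff_separatingLeft
    (fun v w h => (polar_comm _ w v).trans h)]
  intro v hv
  have e01 : ({0, 1} : Finset (Fin 2)) ≠ {0} := by decide
  have e02 : ({0, 1} : Finset (Fin 2)) ≠ {1} := by decide
  have e03 : ({0, 1} : Finset (Fin 2)) ≠ ∅ := by decide
  have e04 : ({0} : Finset (Fin 2)) ≠ {1} := by decide
  have hS : ∀ S : Finset (Fin 2), v S = 0 := by
    intro S
    have hv0 := hv (Pi.single S (Pi.single 0 1))
    have hv1 := hv (Pi.single S (Pi.single 1 1))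
    rw [QuadraticMap.polarBilin_apply_apply, key] at hv0 hv1
    have hm : S ∈ (Finset.univ : Finset (Finset (Fin 2))) := Finset.mem_univ S
    rw [univ_finset_fin_two] at hm
    simp only [Finset.mem_insert, Finset.mem_singleton] at hm
    rcases hm with rfl | rfl | rfl | rfl <;>
      simp [e01, e02, e03, e04, e01.symm, e02.symm, e03.symm,
        e04.symm] at hv0 hv1 <;>
      ext i <;> fin_cases i <;> simp [hv0, hv1]
  exact funext hS

end PfisterForms

section Composition

/-- For a quadratic form permitting composition, three pairwise orthogonal vectors have a
cross product which is orthogonal to each of them. -/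
theorem exists_orthogonal_of_composition {R O : Type} [CommRing R] [AddCommGroup O] [Module R O]
    (Q : QuadraticForm R O) (m : O →ₗ[R] O →ₗ[R] O) (u : O) (hu : ∀ y, m u y = y)
    (hu' : ∀ y, m y u = y) (hQu : Q u = 1) (hm : ∀ y z, Q (m y z) = Q y * Q z)
    (e₁ e₂ e₃ : O) (h₁₂ : polar Q e₁ e₂ = 0) (h₁₃ : polar Q e₁ e₃ = 0)
    (h₂₃ : polar Q e₂ e₃ = 0) :
    ∃ k, Q k = Q e₁ * Q e₂ * Q e₃ ∧ polar Q k e₁ = 0 ∧ polar Q k e₂ = 0 ∧ polar Q k e₃ = 0 := by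
  have left_mul (x y z : O) : polar Q (m x y) (m x z) = Q x * polar Q y z := by
    simp only [polar, ← map_add, hm]
    ring
  have exchange (x w y z : O) :
      polar Q (m x y) (m w z) + polar Q (m w y) (m x z) = polar Q x w * polar Q y z := by
    have h := left_mul (x + w) y z
    simp only [map_add, LinearMap.add_apply, polar_add_left, polar_add_right, left_mul] at h
    rw [show Q (x + w) = polar Q x w + Q x + Q w by simp only [polar]; ring] at h
    linear_combination h
  let conj (x : O) : O := polar Q x u • u - x
  have adjoint (x y z : O) : polar Q (m x y) z = polar Q y (m (conj x) z) := by
    have h := exchange x u y z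
    simp only [hu] at h
    simp only [conj, map_sub, map_smul, LinearMap.sub_apply, LinearMap.smul_apply, hu,
      polar_sub_right, polar_smul_right, smul_eq_mul]
    linear_combination h
  have adjoint' (x y z : O) : polar Q (m (conj x) y) z = polar Q y (m x z) := by
    rw [polar_comm, ← adjoint, polar_comm]
  have norm_conj (x : O) : Q (conj x) = Q x := by
    have h : Q (conj x) = Q (polar Q x u • u + -x) := by rw [← sub_eq_add_neg]
    rw [h, QuadraticMap.map_add Q, polar_smul_left, polar_neg_right, polar_comm Q u x,
      QuadraticMap.map_smul, QuadraticMap.map_neg, hQu]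
    simp only [smul_eq_mul]
    ring
  refine ⟨m e₂ (m (conj e₁) e₃), ?_, ?_, ?_, ?_⟩
  · rw [hm, hm, norm_conj]
    ring
  · have h := exchange (conj e₁) (conj e₂) e₃ e₁
    rw [polar_comm Q e₃ e₁, h₁₃, mul_zero, polar_comm Q (m (conj e₂) e₃), adjoint' e₁ e₁] at h
    have h' : polar Q e₁ (m e₁ (m (conj e₂) e₃)) = 0 := by
      have h'' := left_mul e₁ u (m (conj e₂) e₃)
      rw [hu', polar_comm Q u, adjoint', hu', polar_comm Q e₃, h₂₃, mul_zero] at h''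
      exact h''
    rw [adjoint]
    simpa [h'] using h
  · have h := left_mul e₂ (m (conj e₁) e₃) u
    rwa [hu', adjoint', hu', polar_comm Q e₃, h₁₃, mul_zero] at h
  · have h := exchange e₂ e₃ (m (conj e₁) e₃) u
    rw [hu', hu', h₂₃, zero_mul, adjoint e₃] at h
    have h' := exchange (conj e₁) (conj e₃) e₃ e₂
    rw [polar_comm Q e₃ e₂, h₂₃, mul_zero, adjoint' e₃ e₃] at h'
    have h'' := left_mul e₃ u (m (conj e₁) e₂)
    rw [hu', polar_comm Q u, adjoint', hu', polar_comm Q e₂, h₁₂, mul_zero] at h''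
    rw [h'', add_zero] at h'
    rwa [h', add_zero] at h

end Composition

section Octonions

variable {R : Type} [CommRing R]

/-- The product of the quadratic algebra with norm form `[1,d]`. -/
def etaleMul (d : R) (v w : Fin 2 → R) : Fin 2 → R :=
  ![v 0 * w 0 - d * (v 1 * w 1), v 0 * w 1 + v 1 * w 0 + v 1 * w 1]

/-- The conjugation of the quadratic algebra with norm form `[1,d]`. -/
def etaleConj (v : Fin 2 → R) : Fin 2 → R := ![v 0 + v 1, -v 1]

/-- The octonion product, obtained from `etaleMul` by two Cayley–Dickson doublings. -/
def octMul (a b d : R) (z w : Finset (Fin 2) → Fin 2 → R) : Finset (Fin 2) → Fin 2 → R :=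
  fun S => if 0 ∈ S then
    if 1 ∈ S then etaleMul d (z {0}) (w {1}) + etaleMul d (z {0, 1}) (w ∅)
        + etaleMul d (w {0, 1}) (etaleConj (z ∅)) - etaleMul d (w {0}) (z {1})
    else etaleMul d (w {0}) (z ∅) + etaleMul d (z {0}) (etaleConj (w ∅))
      - b • (etaleMul d (z {0, 1}) (etaleConj (w {1})) - etaleMul d (w {0, 1}) (etaleConj (z {1})))
  else
    if 1 ∈ S then etaleMul d (w {1}) (z ∅) - a • etaleMul d (etaleConj (z {0})) (w {0, 1})
        + etaleMul d (z {1}) (etaleConj (w ∅)) + a • etaleMul d (etaleConj (w {0})) (z {0, 1})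
    else etaleMul d (z ∅) (w ∅) - a • etaleMul d (etaleConj (w {0})) (z {0})
      - b • (etaleMul d (etaleConj (w {1})) (z {1})
        + a • etaleMul d (etaleConj (z {0, 1})) (w {0, 1}))

theorem octMul_empty (a b d : R) (z w : Finset (Fin 2) → Fin 2 → R) :
    octMul a b d z w ∅ = etaleMul d (z ∅) (w ∅) - a • etaleMul d (etaleConj (w {0})) (z {0})
      - b • (etaleMul d (etaleConj (w {1})) (z {1})
        + a • etaleMul d (etaleConj (z {0, 1})) (w {0, 1})) := by
  simp [octMul]

theorem octMul_zero (a b d : R) (z w : Finset (Fin 2) → Fin 2 → R) :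
    octMul a b d z w {0} = etaleMul d (w {0}) (z ∅) + etaleMul d (z {0}) (etaleConj (w ∅))
      - b • (etaleMul d (z {0, 1}) (etaleConj (w {1}))
        - etaleMul d (w {0, 1}) (etaleConj (z {1}))) := by
  simp [octMul]

theorem octMul_one (a b d : R) (z w : Finset (Fin 2) → Fin 2 → R) :
    octMul a b d z w {1} = etaleMul d (w {1}) (z ∅) - a • etaleMul d (etaleConj (z {0})) (w {0, 1})
        + etaleMul d (z {1}) (etaleConj (w ∅)) + a • etaleMul d (etaleConj (w {0})) (z {0, 1}) := by
  simp [octMul]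

theorem octMul_zero_one (a b d : R) (z w : Finset (Fin 2) → Fin 2 → R) :
    octMul a b d z w {0, 1} = etaleMul d (z {0}) (w {1}) + etaleMul d (z {0, 1}) (w ∅)
        + etaleMul d (w {0, 1}) (etaleConj (z ∅)) - etaleMul d (w {0}) (z {1}) := by
  simp [octMul]

set_option maxRecDepth 10000 in
theorem pfisterQF_octMul (a : Fin 2 → R) (d : R) (z w : Finset (Fin 2) → Fin 2 → R) :
    pfisterQF 2 a d (octMul (a 0) (a 1) d z w) = pfisterQF 2 a d z * pfisterQF 2 a d w := by
  rw [pfisterQF_two_apply, pfisterQF_two_apply, pfisterQF_two_apply, octMul_empty, octMul_zero,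
    octMul_one, octMul_zero_one]
  simp only [etaleMul, etaleConj, Pi.add_apply, Pi.sub_apply, Pi.smul_apply, smul_eq_mul,
    Matrix.cons_val_zero, Matrix.cons_val_one]
  ring

/-- The octonion product as a bilinear map. -/
def octMulBilin (a b d : R) : (Finset (Fin 2) → Fin 2 → R) →ₗ[R]
    (Finset (Fin 2) → Fin 2 → R) →ₗ[R] (Finset (Fin 2) → Fin 2 → R) :=
  LinearMap.mk₂ R (octMul a b d)
    (fun z z' w => by
      ext S i
      by_cases h0 : 0 ∈ S <;> by_cases h1 : 1 ∈ S <;> fin_cases i <;>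
        simp [octMul, etaleMul, etaleConj, h0, h1] <;> ring)
    (fun t z w => by
      ext S i
      by_cases h0 : 0 ∈ S <;> by_cases h1 : 1 ∈ S <;> fin_cases i <;>
        simp [octMul, etaleMul, etaleConj, h0, h1] <;> ring)
    (fun z w w' => by
      ext S i
      by_cases h0 : 0 ∈ S <;> by_cases h1 : 1 ∈ S <;> fin_cases i <;>
        simp [octMul, etaleMul, etaleConj, h0, h1] <;> ring)
    (fun t z w => by
      ext S i
      by_cases h0 : 0 ∈ S <;> by_cases h1 : 1 ∈ S <;> fin_cases i <;>
        simp [octMul, etaleMul, etaleConj, h0, h1] <;> ring)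

theorem forall_finset_fin_two {p : Finset (Fin 2) → Prop} :
    (∀ S, p S) ↔ p ∅ ∧ p {0} ∧ p {1} ∧ p {0, 1} := by
  constructor
  · exact fun hp => ⟨hp _, hp _, hp _, hp _⟩
  · rintro ⟨h₁, h₂, h₃, h₄⟩ S
    have hS : S ∈ (Finset.univ : Finset (Finset (Fin 2))) := Finset.mem_univ S
    rw [univ_finset_fin_two] at hS
    simp only [Finset.mem_insert, Finset.mem_singleton] at hS
    rcases hS with rfl | rfl | rfl | rfl <;> assumption

theorem octMul_unit_left (a b d : R) (z : Finset (Fin 2) → Fin 2 → R) :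
    octMul a b d (Pi.single ∅ ![1, 0]) z = z := by
  have e₁ : ({0, 1} : Finset (Fin 2)) ≠ ∅ := by decide
  rw [funext_iff, forall_finset_fin_two, octMul_empty, octMul_zero, octMul_one, octMul_zero_one]
  refine ⟨?_, ?_, ?_, ?_⟩ <;> ext i <;> fin_cases i <;> simp [etaleMul, etaleConj, e₁]

theorem octMul_unit_right (a b d : R) (z : Finset (Fin 2) → Fin 2 → R) :
    octMul a b d z (Pi.single ∅ ![1, 0]) = z := by
  have e₁ : ({0, 1} : Finset (Fin 2)) ≠ ∅ := by decide
  rw [funext_iff, forall_finset_fin_two, octMul_empty, octMul_zero, octMul_one, octMul_zero_one]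
  refine ⟨?_, ?_, ?_, ?_⟩ <;> ext i <;> fin_cases i <;> simp [etaleMul, etaleConj, e₁]

theorem pfisterQF_two_unit (a : Fin 2 → R) (d : R) :
    pfisterQF 2 a d (Pi.single ∅ ![1, 0]) = 1 := by
  have e₁ : ({0, 1} : Finset (Fin 2)) ≠ ∅ := by decide
  simp [pfisterQF_two_apply, e₁]

/-- Three pairwise orthogonal vectors of a 3-fold Pfister form have a cross product. -/
theorem exists_orthogonal_pfisterQF (a : Fin 2 → R) (d : R)
    (e₁ e₂ e₃ : Finset (Fin 2) → Fin 2 → R)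
    (h₁₂ : polar (pfisterQF 2 a d) e₁ e₂ = 0) (h₁₃ : polar (pfisterQF 2 a d) e₁ e₃ = 0)
    (h₂₃ : polar (pfisterQF 2 a d) e₂ e₃ = 0) :
    ∃ k, pfisterQF 2 a d k = pfisterQF 2 a d e₁ * pfisterQF 2 a d e₂ * pfisterQF 2 a d e₃ ∧
      polar (pfisterQF 2 a d) k e₁ = 0 ∧ polar (pfisterQF 2 a d) k e₂ = 0 ∧
      polar (pfisterQF 2 a d) k e₃ = 0 :=
  exists_orthogonal_of_composition _ (octMulBilin (a 0) (a 1) d) _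
    (octMul_unit_left (a 0) (a 1) d) (octMul_unit_right (a 0) (a 1) d) (pfisterQF_two_unit a d)
    (pfisterQF_octMul a d) e₁ e₂ e₃ h₁₂ h₁₃ h₂₃

end Octonions

section Splitting

variable {K : Type} [Field K]

theorem quatAlg_exists_coords (x a : K) :
    ∃ h : (Fin 4 → K) →ₗ[K] QuatAlg K x a, Function.Surjective h := by
  let π : FreeAlgebra K (Fin 2) →ₐ[K] QuatAlg K x a := RingQuot.mkAlgHom K (QuatRel K x a)
  have hπ : Function.Surjective π := RingQuot.mkAlgHom_surjective K (QuatRel K x a)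
  let i := π (FreeAlgebra.ι K 0)
  let j := π (FreeAlgebra.ι K 1)
  have hii : i * i + i = algebraMap K _ x := by
    have h := RingQuot.mkAlgHom_rel K (QuatRel.i_sq (K := K) (a := x) (b := a))
    rw [map_add, map_mul, AlgHom.commutes] at h
    exact h
  have hjj : j * j = algebraMap K _ a := by
    have h := RingQuot.mkAlgHom_rel K (QuatRel.j_sq (K := K) (a := x) (b := a))
    rw [map_mul, AlgHom.commutes] at h
    exact h
  have hji : j * i = i * j + j := by
    have h := RingQuot.mkAlgHom_rel K (QuatRel.swap (K := K) (a := x) (b := a))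
    rw [map_add, map_mul, map_mul] at h
    exact h
  have hii' : i * i = x • 1 - i := by rw [← Algebra.algebraMap_eq_smul_one, ← hii]; abel
  have hjj' : j * j = a • 1 := by rw [← Algebra.algebraMap_eq_smul_one, hjj]
  have hiij : i * (i * j) = x • j - i * j := by
    rw [← mul_assoc, hii', sub_mul, smul_mul_assoc, one_mul]
  have hjij : j * (i * j) = a • i + a • 1 := by
    rw [← mul_assoc, hji, add_mul, mul_assoc, hjj', mul_smul_comm, mul_one]
  let h : (Fin 4 → K) →ₗ[K] QuatAlg K x a := Fintype.linearCombination K ![1, i, j, i * j]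
  have h_apply (t : Fin 4 → K) : h t = t 0 • 1 + t 1 • i + t 2 • j + t 3 • (i * j) := by
    simp [h, Fintype.linearCombination_apply, Fin.sum_univ_four]
  refine ⟨h, fun z => ?_⟩
  obtain ⟨p, rfl⟩ := hπ z
  suffices H : ∀ t, ∃ t', h t' = π p * h t by
    obtain ⟨t, ht⟩ := H ![1, 0, 0, 0]
    refine ⟨t, ht.trans ?_⟩
    simp [h_apply]
  induction p using FreeAlgebra.induction with
  | grade0 r =>
    intro t
    exact ⟨r • t, by rw [map_smul, AlgHom.commutes, Algebra.smul_def]⟩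
  | grade1 n =>
    intro t
    fin_cases n
    · refine ⟨![x * t 1, t 0 - t 1, x * t 3, t 2 - t 3], ?_⟩
      change _ = i * _
      simp only [h_apply, mul_add, mul_smul_comm, mul_one, hii', hiij]
      simp only [Matrix.cons_val]
      module
    · refine ⟨![a * t 2 + a * t 3, a * t 3, t 0 + t 1, t 1], ?_⟩
      change _ = j * _
      simp only [h_apply, mul_add, mul_smul_comm, mul_one, hji, hjj', hjij]
      simp only [Matrix.cons_val]
      module
  | mul p q hp hq =>
    intro t
    obtain ⟨t₁, h₁⟩ := hq t
    obtain ⟨t₂, h₂⟩ := hp t₁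
    exact ⟨t₂, by rw [h₂, h₁, map_mul, mul_assoc]⟩
  | add p q hp hq =>
    intro t
    obtain ⟨t₁, h₁⟩ := hp t
    obtain ⟨t₂, h₂⟩ := hq t
    exact ⟨t₁ + t₂, by rw [map_add, map_add, add_mul, h₁, h₂]⟩

/-- A surjection from a quaternion algebra onto the `2×2` matrices is an isomorphism. -/
theorem quatSplit_of_surjective {x a : K} (f : QuatAlg K x a →ₐ[K] Matrix (Fin 2) (Fin 2) K)
    (hf : Function.Surjective f) : QuatSplit K x a := by
  obtain ⟨h, hh⟩ := quatAlg_exists_coords x a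
  have hinj : Function.Injective (f.toLinearMap ∘ₗ h) := by
    rw [LinearMap.injective_iff_surjective_of_finrank_eq_finrank]
    · exact hf.comp hh
    · simp [Module.finrank_matrix]
  refine ⟨AlgEquiv.ofBijective f ⟨fun y z hyz => ?_, hf⟩⟩
  obtain ⟨s, rfl⟩ := hh y
  obtain ⟨t, rfl⟩ := hh z
  exact congrArg h (hinj hyz)

theorem exists_norm_of_quatSplit [CharP K 2] {x a : K} (hs : QuatSplit K x a) :
    ∃ u v : K, a = u ^ 2 + u * v + x * v ^ 2 := by
  obtain ⟨f⟩ := hs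
  let π : FreeAlgebra K (Fin 2) →ₐ[K] QuatAlg K x a := RingQuot.mkAlgHom K (QuatRel K x a)
  let g : FreeAlgebra K (Fin 2) →ₐ[K] Matrix (Fin 2) (Fin 2) K := f.toAlgHom.comp π
  obtain ⟨I, hI⟩ : ∃ I, I = g (FreeAlgebra.ι K 0) := ⟨_, rfl⟩
  obtain ⟨J, hJ⟩ : ∃ J, J = g (FreeAlgebra.ι K 1) := ⟨_, rfl⟩
  have hg {p q : FreeAlgebra K (Fin 2)} (h : QuatRel K x a p q) : g p = g q :=
    congrArg f (RingQuot.mkAlgHom_rel K h)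
  have hII : I * I + I = algebraMap K _ x := by
    simpa [hI] using hg QuatRel.i_sq
  have hJJ : J * J = algebraMap K _ a := by
    simpa [hJ] using hg QuatRel.j_sq
  have hJI : J * I = I * J + J := by
    simpa [hI, hJ] using hg QuatRel.swap
  have h2 : (2 : K) = 0 := CharTwo.two_eq_zero
  have key (w : Fin 2 → K) (hw : w ≠ 0) (u v : K)
      (h : J.mulVec w = u • w + v • I.mulVec w) : a = u ^ 2 + u * v + x * v ^ 2 := by
    have hIIw : I.mulVec (I.mulVec w) = x • w - I.mulVec w := by
      rw [Matrix.mulVec_mulVec, eq_sub_iff_add_eq, ← Matrix.add_mulVec, hII,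
        Algebra.algebraMap_eq_smul_one, Matrix.smul_mulVec, Matrix.one_mulVec]
    have hJJw : J.mulVec (J.mulVec w) = a • w := by
      rw [Matrix.mulVec_mulVec, hJJ,
        Algebra.algebraMap_eq_smul_one, Matrix.smul_mulVec, Matrix.one_mulVec]
    have hJIw : J.mulVec (I.mulVec w) = I.mulVec (J.mulVec w) + J.mulVec w := by
      rw [Matrix.mulVec_mulVec, hJI, Matrix.add_mulVec, Matrix.mulVec_mulVec]
    have e : a • w = (u ^ 2 + u * v + x * v ^ 2) • w + (2 * (u * v)) • I.mulVec w := by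
      rw [← hJJw, h, Matrix.mulVec_add, Matrix.mulVec_smul, Matrix.mulVec_smul, hJIw, h,
        Matrix.mulVec_add, Matrix.mulVec_smul, Matrix.mulVec_smul, hIIw]
      module
    rw [h2, zero_mul, zero_smul, add_zero] at e
    exact smul_left_injective K hw e
  by_cases h10 : I 1 0 = 0
  · by_cases h01 : I 0 1 = 0
    · have h00 := congrFun (congrFun hII 0) 0
      simp [Matrix.mul_apply, Fin.sum_univ_two, h01, Matrix.algebraMap_matrix_apply] at h00
      refine ⟨a + I 0 0 * (a + 1), a + 1, ?_⟩
      rw [← h00]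
      linear_combination (-a^2 - a *(a+1) * I 0 0 - (a+1)^2 * I 0 0 ^ 2
        - I 0 0 * (a + 1) ^ 2) * h2
    · refine ⟨_, _, key ![0, 1] (by simp) (J 1 1 - J 0 1 / I 0 1 * I 1 1) (J 0 1 / I 0 1) ?_⟩
      ext n
      fin_cases n
      · simp [Matrix.mulVec, dotProduct, Fin.sum_univ_two, h01]
      · simp [Matrix.mulVec, dotProduct, Fin.sum_univ_two]
  · refine ⟨_, _, key ![1, 0] (by simp) (J 0 0 - J 1 0 / I 1 0 * I 0 0) (J 1 0 / I 1 0) ?_⟩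
    ext n
    fin_cases n
    · simp [Matrix.mulVec, dotProduct, Fin.sum_univ_two]
    · simp [Matrix.mulVec, dotProduct, Fin.sum_univ_two, h10]

theorem quatSplit_of_norm [CharP K 2] {x a : K} (ha : a ≠ 0)
    (h : ∃ u v : K, a = u ^ 2 + u * v + x * v ^ 2) : QuatSplit K x a := by
  obtain ⟨u, v, huv⟩ := h
  have h2 : (2 : K) = 0 := CharTwo.two_eq_zero
  let I : Matrix (Fin 2) (Fin 2) K := !![0, x; 1, 1]
  let J : Matrix (Fin 2) (Fin 2) K := !![u, u + v * x; v, u]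
  have hIJ : ∀ {p q}, QuatRel K x a p q →
      FreeAlgebra.lift K ![I, J] p = FreeAlgebra.lift K ![I, J] q := by
    rintro _ _ (_ | _ | _) <;>
      simp only [map_add, map_mul, FreeAlgebra.lift_ι_apply, AlgHom.commutes, Matrix.cons_val, I, J]
    · ext i j
      fin_cases i <;> fin_cases j <;>
        simp [Matrix.algebraMap_matrix_apply]
      · linear_combination x * h2
      · linear_combination h2
      · linear_combination h2
    · ext i j
      fin_cases i <;> fin_cases j <;>
        simp [Matrix.algebraMap_matrix_apply]
      · linear_combination -huv
      · linear_combination u * (u + v * x) * h2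
      · linear_combination u * v * h2
      · linear_combination -huv
    · ext i j
      fin_cases i <;> fin_cases j <;>
        simp [Matrix.mul_apply, Fin.sum_univ_two]
      · ring
      · ring
      · linear_combination -v * h2
      · linear_combination -u * h2
  let f : QuatAlg K x a →ₐ[K] Matrix (Fin 2) (Fin 2) K :=
    RingQuot.liftAlgHom K ⟨FreeAlgebra.lift K ![I, J], fun _ _ h => hIJ h⟩
  have hf (p) : f (RingQuot.mkAlgHom K _ p) = FreeAlgebra.lift K ![I, J] p :=
    RingQuot.liftAlgHom_mkAlgHom_apply ..
  refine quatSplit_of_surjective f ?_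
  rw [← AlgHom.range_eq_top]
  have hI : I ∈ f.range := ⟨_, (hf (FreeAlgebra.ι K 0)).trans (by simp)⟩
  have hJ : J ∈ f.range := ⟨_, (hf (FreeAlgebra.ι K 1)).trans (by simp)⟩
  have haa : a⁻¹ * a = 1 := inv_mul_cancel₀ ha
  let S : Subalgebra K (Matrix (Fin 2) (Fin 2) K) := f.range
  have hscalar (t : K) : algebraMap K (Matrix (Fin 2) (Fin 2) K) t ∈ S := S.algebraMap_mem t
  have hE01 : (!![0, 1; 0, 0] : Matrix (Fin 2) (Fin 2) K) ∈ S := by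
    have h := S.add_mem (S.smul_mem (S.mul_mem (S.add_mem (hscalar (u + v))
      (S.smul_mem hI v)) hJ) a⁻¹) S.one_mem
    convert h using 1
    ext i j
    fin_cases i <;> fin_cases j <;>
        simp [Matrix.algebraMap_matrix_apply, Matrix.mul_apply, Fin.sum_univ_two, I, J]
    · linear_combination a⁻¹ * huv - haa - h2
    · linear_combination a⁻¹ * huv - haa - a⁻¹ * u * v * x * h2
    · exact Or.inr (by linear_combination (u * v + v ^ 2) * h2)
    · linear_combination a⁻¹ * huv - haa - h2 - a⁻¹ * u * v * h2
  have hE00 : (!![1, 0; 0, 0] : Matrix (Fin 2) (Fin 2) K) ∈ S := by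
    have h := S.sub_mem (S.mul_mem hE01 hI) hE01
    convert h using 1
    ext i j
    fin_cases i <;> fin_cases j <;> simp [I]
  have hE10 : (!![0, 0; 1, 0] : Matrix (Fin 2) (Fin 2) K) ∈ S := by
    have h := S.mul_mem hI hE00
    convert h using 1
    ext i j
    fin_cases i <;> fin_cases j <;> simp [I]
  have hE11 : (!![0, 0; 0, 1] : Matrix (Fin 2) (Fin 2) K) ∈ S := by
    have h := S.sub_mem S.one_mem hE00
    convert h using 1
    ext i j
    fin_cases i <;> fin_cases j <;> simp
  rw [eq_top_iff]
  intro M _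
  have h := S.add_mem (S.add_mem (S.smul_mem hE00 (M 0 0)) (S.smul_mem hE01 (M 0 1)))
    (S.add_mem (S.smul_mem hE10 (M 1 0)) (S.smul_mem hE11 (M 1 1)))
  convert h using 1
  ext i j
  fin_cases i <;> fin_cases j <;> simp

end Splitting

section SquareRoots

variable {F : Type} [Field F] [CharP F 2]

/-- Over `F(√b,√c)` every square is a value of `⟨1,b,c,bc⟩`. -/
theorem exists_sq_eq_of_mem_sqrtExt (b c : F) (z : sqrtExt F ![b, c]) :
    ∃ n : Fin 4 → F, z ^ 2 = algebraMap F (sqrtExt F ![b, c])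
      (n 0 ^ 2 + b * n 1 ^ 2 + c * n 2 ^ 2 + b * c * n 3 ^ 2) := by
  let E := AlgebraicClosure F
  let φ := algebraMap F E
  have h2 : (2 : E) = 0 := by
    rw [← map_ofNat φ 2, CharTwo.two_eq_zero, map_zero]
  obtain ⟨β, hβ⟩ := IsAlgClosed.exists_pow_nat_eq (φ b) (n := 2) (by norm_num)
  obtain ⟨γ, hγ⟩ := IsAlgClosed.exists_pow_nat_eq (φ c) (n := 2) (by norm_num)
  have hsq (n : Fin 4 → F) : (φ (n 0) + φ (n 1) * β + φ (n 2) * γ + φ (n 3) * (β * γ)) ^ 2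
      = φ (n 0 ^ 2 + b * n 1 ^ 2 + c * n 2 ^ 2 + b * c * n 3 ^ 2) := by
    simp only [map_add, map_mul, map_pow, ← hβ, ← hγ]
    linear_combination (φ (n 0) * (φ (n 1) * β + φ (n 2) * γ + φ (n 3) * (β * γ))
      + φ (n 1) * β * (φ (n 2) * γ + φ (n 3) * (β * γ))
      + φ (n 2) * γ * (φ (n 3) * (β * γ))) * h2
  have eq_of_sq_eq {y w : E} (h : y ^ 2 = w ^ 2) : y = w := by
    have : (y - w) ^ 2 = 0 := by linear_combination h + (w ^ 2 - y * w) * h2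
    exact sub_eq_zero.mp (pow_eq_zero_iff two_ne_zero |>.mp this)
  suffices H : ∀ y ∈ sqrtExt F ![b, c], ∃ n : Fin 4 → F,
      y = φ (n 0) + φ (n 1) * β + φ (n 2) * γ + φ (n 3) * (β * γ) by
    obtain ⟨n, hn⟩ := H z z.2
    refine ⟨n, Subtype.ext ?_⟩
    change (z : E) ^ 2 = φ _
    rw [hn, hsq]
  intro y hy
  induction hy using IntermediateField.adjoin_induction with
  | mem y hy =>
    obtain ⟨i, hi⟩ := hy
    fin_cases i
    · exact ⟨![0, 1, 0, 0], by simpa using eq_of_sq_eq (hi.trans hβ.symm)⟩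
    · exact ⟨![0, 0, 1, 0], by simpa using eq_of_sq_eq (hi.trans hγ.symm)⟩
  | algebraMap r => exact ⟨![r, 0, 0, 0], by simp [φ, E]⟩
  | add y w _ _ hy hw =>
    obtain ⟨n, rfl⟩ := hy
    obtain ⟨m, rfl⟩ := hw
    refine ⟨n + m, ?_⟩
    simp only [Pi.add_apply, map_add]
    ring
  | inv y _ hy =>
    obtain ⟨n, hn⟩ := hy
    obtain ⟨N, hN⟩ : ∃ N, y ^ 2 = φ N := ⟨_, by rw [hn, hsq]⟩
    refine ⟨N⁻¹ • n, ?_⟩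
    have h : y⁻¹ = φ N⁻¹ * y := by
      rw [map_inv₀, ← hN]
      by_cases hy0 : y = 0
      · simp [hy0]
      · field_simp
    rw [h]
    nth_rewrite 1 [hn]
    simp only [Pi.smul_apply, smul_eq_mul, map_mul]
    ring
  | mul y w _ _ hy hw =>
    obtain ⟨n, rfl⟩ := hy
    obtain ⟨m, rfl⟩ := hw
    refine ⟨![n 0 * m 0 + b * (n 1 * m 1) + c * (n 2 * m 2) + b * c * (n 3 * m 3),
      n 0 * m 1 + n 1 * m 0 + c * (n 2 * m 3 + n 3 * m 2),
      n 0 * m 2 + n 2 * m 0 + b * (n 1 * m 3 + n 3 * m 1),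
      n 0 * m 3 + n 3 * m 0 + n 1 * m 2 + n 2 * m 1], ?_⟩
    simp only [Matrix.cons_val, map_add, map_mul, ← hβ, ← hγ]
    ring

theorem exists_sq_eq_in_sqrtExt (b c : F) (n : Fin 4 → F) :
    ∃ z : sqrtExt F ![b, c], z ^ 2 = algebraMap F (sqrtExt F ![b, c])
      (n 0 ^ 2 + b * n 1 ^ 2 + c * n 2 ^ 2 + b * c * n 3 ^ 2) := by
  let E := sqrtExt F ![b, c]
  have h2 : (2 : E) = 0 := by
    rw [← map_ofNat (algebraMap F E) 2, CharTwo.two_eq_zero, map_zero]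
  have hroot (i : Fin 2) : ∃ z : E, z ^ 2 = algebraMap F E (![b, c] i) := by
    obtain ⟨β, hβ⟩ := IsAlgClosed.exists_pow_nat_eq
      (algebraMap F (AlgebraicClosure F) (![b, c] i)) (n := 2) (by norm_num)
    exact ⟨⟨β, IntermediateField.subset_adjoin _ _ ⟨i, hβ⟩⟩, Subtype.ext hβ⟩
  obtain ⟨β, hβ⟩ := hroot 0
  obtain ⟨γ, hγ⟩ := hroot 1
  let φ := algebraMap F E
  refine ⟨φ (n 0) + φ (n 1) * β + φ (n 2) * γ + φ (n 3) * (β * γ), ?_⟩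
  simp only [Matrix.cons_val_zero, Matrix.cons_val_one] at hβ hγ
  rw [map_add, map_add, map_add, map_mul, map_mul, map_mul, map_mul, map_pow, map_pow, map_pow,
    map_pow, ← hβ, ← hγ]
  linear_combination (φ (n 0) * (φ (n 1) * β + φ (n 2) * γ + φ (n 3) * (β * γ))
      + φ (n 1) * β * (φ (n 2) * γ + φ (n 3) * (β * γ))
      + φ (n 2) * γ * (φ (n 3) * (β * γ))) * h2

end SquareRoots

section Main

variable {F : Type} [Field F]

theorem form_apply (a x b c : F) (v : (Fin 2 → F) × (Fin 3 → F)) :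
    (((a : F) • binQF 1 x).prod (diagQF ![1, b, c])) v =
      a * (v.1 0 ^ 2 + v.1 0 * v.1 1 + x * v.1 1 ^ 2) +
        (v.2 0 ^ 2 + b * v.2 1 ^ 2 + c * v.2 2 ^ 2) := by
  simp [QuadraticMap.prod_apply, smul_apply, binQF_apply, diagQF_three_apply]

theorem eq_zero_of_form_eq_zero {a x b c : F}
    (h : ((a • binQF 1 x).prod (diagQF ![1, b, c])).Anisotropic) {p q r s t : F}
    (h0 : a * (p ^ 2 + p * q + x * q ^ 2) + (r ^ 2 + b * s ^ 2 + c * t ^ 2) = 0) :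
    p = 0 ∧ q = 0 ∧ r = 0 ∧ s = 0 ∧ t = 0 := by
  have hz := h (![p, q], ![r, s, t]) (by rw [form_apply]; simpa using h0)
  have h₁ := congrArg Prod.fst hz
  have h₂ := congrArg Prod.snd hz
  exact ⟨congrFun h₁ 0, congrFun h₁ 1, congrFun h₂ 0, congrFun h₂ 1, congrFun h₂ 2⟩

variable [CharP F 2]

theorem quatSplit_sqrtExt_iff {a x b c : F} (ha : a ≠ 0)
    (h : ((a • binQF 1 x).prod (diagQF ![1, b, c])).Anisotropic) :
    QuatSplit (sqrtExt F ![b, c]) (algebraMap F _ x) (algebraMap F _ a) ↔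
      ∃ (l m : F) (n : Fin 4 → F), (l ≠ 0 ∨ m ≠ 0) ∧ a * (l ^ 2 + l * m + x * m ^ 2) =
        n 0 ^ 2 + b * n 1 ^ 2 + c * n 2 ^ 2 + b * c * n 3 ^ 2 := by
  have hchar : CharP (sqrtExt F ![b, c]) 2 := charP_of_injective_algebraMap' F 2
  let φ := algebraMap F (sqrtExt F ![b, c])
  have hφ : Function.Injective φ := φ.injective
  constructor
  · intro hs
    obtain ⟨u, v, huv⟩ := exists_norm_of_quatSplit hs
    obtain ⟨n, hn⟩ := exists_sq_eq_of_mem_sqrtExt b c u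
    by_cases hv : v = 0
    · refine ⟨1, 0, n, Or.inl one_ne_zero, hφ ?_⟩
      rw [← hn]
      simp only [map_mul, map_add, map_pow, map_one, map_zero]
      rw [huv, hv]
      ring
    · obtain ⟨k, hk⟩ := exists_sq_eq_of_mem_sqrtExt b c v
      obtain ⟨N, hN⟩ : ∃ N : F, N = k 0 ^ 2 + b * k 1 ^ 2 + c * k 2 ^ 2 + b * c * k 3 ^ 2 :=
        ⟨_, rfl⟩
      obtain ⟨M, hM⟩ : ∃ M : F, M = n 0 ^ 2 + b * n 1 ^ 2 + c * n 2 ^ 2 + b * c * n 3 ^ 2 :=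
        ⟨_, rfl⟩
      rw [← hN] at hk
      rw [← hM] at hn
      have hN0 : φ N ≠ 0 := by
        rw [← hk]
        exact pow_ne_zero 2 hv
      have hu : u = φ ((a - M - x * N) / N) * v := by
        rw [map_div₀, div_mul_eq_mul_div, eq_div_iff hN0]
        simp only [map_sub, map_mul]
        rw [← hn, huv, ← hk]
        ring
      obtain ⟨s, hs⟩ : ∃ s, s = (a - M - x * N) / N := ⟨_, rfl⟩
      rw [← hs] at hu
      have haN : a = N * (s ^ 2 + s + x) := by
        apply hφ
        simp only [map_add, map_mul, map_pow]
        rw [huv, ← hk, hu]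
        ring
      refine ⟨s, 1, (s ^ 2 + s + x) • k, Or.inr one_ne_zero, ?_⟩
      rw [haN, hN]
      simp only [Pi.smul_apply, smul_eq_mul]
      ring
  · rintro ⟨l, m, n, hlm, h0⟩
    obtain ⟨w, hw⟩ := exists_sq_eq_in_sqrtExt b c n
    have hD : l ^ 2 + l * m + x * m ^ 2 ≠ 0 := by
      intro hD
      have := eq_zero_of_form_eq_zero h (p := l) (q := m) (r := 0) (s := 0) (t := 0) (by
        rw [hD]; ring)
      tauto
    refine quatSplit_of_norm (by simpa using ha) ⟨φ (l / (l ^ 2 + l * m + x * m ^ 2)) * w,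
      φ (m / (l ^ 2 + l * m + x * m ^ 2)) * w, ?_⟩
    have e : (φ (l / (l ^ 2 + l * m + x * m ^ 2)) * w) ^ 2
        + φ (l / (l ^ 2 + l * m + x * m ^ 2)) * w * (φ (m / (l ^ 2 + l * m + x * m ^ 2)) * w)
        + φ x * (φ (m / (l ^ 2 + l * m + x * m ^ 2)) * w) ^ 2
        = φ ((l / (l ^ 2 + l * m + x * m ^ 2)) ^ 2
          + l / (l ^ 2 + l * m + x * m ^ 2) * (m / (l ^ 2 + l * m + x * m ^ 2))
          + x * (m / (l ^ 2 + l * m + x * m ^ 2)) ^ 2) * w ^ 2 := by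
      simp only [map_add, map_mul, map_pow]
      ring
    refine Eq.trans ?_ e.symm
    rw [hw, ← h0, ← map_mul]
    congr 1
    generalize hE : l ^ 2 + l * m + x * m ^ 2 = E at hD ⊢
    have e' : (l / E) ^ 2 + l / E * (m / E) + x * (m / E) ^ 2
        = (l ^ 2 + l * m + x * m ^ 2) / E ^ 2 := by ring
    rw [e', hE]
    field_simp

theorem isPfisterNeighbour_of_norm {a x b c : F} (hb : b ≠ 0) (hc : c ≠ 0)
    (h : ((a • binQF 1 x).prod (diagQF ![1, b, c])).Anisotropic) {l m : F} {n : Fin 4 → F}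
    (hlm : l ≠ 0 ∨ m ≠ 0) (h0 : a * (l ^ 2 + l * m + x * m ^ 2) =
      n 0 ^ 2 + b * n 1 ^ 2 + c * n 2 ^ 2 + b * c * n 3 ^ 2) :
    IsPfisterNeighbour ((a • binQF 1 x).prod (diagQF ![1, b, c])) := by
  have h2 : (2 : F) = 0 := CharTwo.two_eq_zero
  obtain ⟨D, hD⟩ : ∃ D, D = l ^ 2 + l * m + x * m ^ 2 := ⟨_, rfl⟩
  obtain ⟨N, hN⟩ : ∃ N, N = n 0 ^ 2 + b * n 1 ^ 2 + c * n 2 ^ 2 + b * c * n 3 ^ 2 := ⟨_, rfl⟩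
  have hn : n 3 ≠ 0 := by
    intro hn
    have := eq_zero_of_form_eq_zero h (p := l) (q := m) (r := n 0) (s := n 1) (t := n 2) (by
      rw [h0, hn]
      linear_combination (n 0 ^ 2 + b * n 1 ^ 2 + c * n 2 ^ 2) * h2)
    tauto
  have hD0 : D ≠ 0 := by
    intro hD0
    have := eq_zero_of_form_eq_zero h (p := l) (q := m) (r := 0) (s := 0) (t := 0) (by
      rw [← hD, hD0]; ring)
    tauto
  have ha : a ≠ 0 := by
    rintro rfl
    have := (eq_zero_of_form_eq_zero h (p := 1) (q := 0) (r := 0) (s := 0) (t := 0) (by ring)).1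
    exact one_ne_zero this
  rw [← hD, ← hN] at h0
  have hN0 : N ≠ 0 := h0 ▸ mul_ne_zero ha hD0
  let P : Module.Dual F ((Fin 2 → F) × (Fin 3 → F)) :=
    (D⁻¹ • (l • LinearMap.proj 0 + (x * m) • LinearMap.proj 1)) ∘ₗ LinearMap.fst _ _ _
  let Q : Module.Dual F ((Fin 2 → F) × (Fin 3 → F)) :=
    (D⁻¹ • (m • LinearMap.proj 0 + (l + m) • LinearMap.proj 1)) ∘ₗ LinearMap.fst _ _ _
  have hP (v) : P v = D⁻¹ * (l * v.1 0 + x * m * v.1 1) := rfl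
  have hQ (v) : Q v = D⁻¹ * (m * v.1 0 + (l + m) * v.1 1) := rfl
  let r (i : Fin 3) : Module.Dual F ((Fin 2 → F) × (Fin 3 → F)) :=
    LinearMap.proj i ∘ₗ LinearMap.snd _ _ _
  have hr (i v) : r i v = v.2 i := rfl
  let f : (Fin 2 → F) × (Fin 3 → F) →ₗ[F] (Finset (Fin 2) → Fin 2 → F) :=
    LinearMap.pi fun S => LinearMap.pi fun i =>
      if 0 ∈ S then
        if 1 ∈ S then if i = 0 then n 3 • P else (N / (n 3 * (b * c))) • Q
        else if i = 0 then r 1 + n 1 • P else 0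
      else
        if 1 ∈ S then if i = 0 then r 2 + n 2 • P else 0
        else if i = 0 then r 0 + n 0 • P else 0
  have hf (v) : pfisterQF 2 ![b, c] (x * n 3 ^ 2 * (b * c) / N) (f v)
      = ((a • binQF 1 x).prod (diagQF ![1, b, c])) v := by
    rw [form_apply, pfisterQF_two_apply]
    simp only [f, LinearMap.pi_apply, Finset.mem_insert, Finset.mem_singleton,
      Finset.notMem_empty, if_true, if_false, Fin.isValue, one_ne_zero, zero_ne_one, or_false,
      or_true, LinearMap.add_apply, LinearMap.smul_apply, smul_eq_mul, LinearMap.zero_apply, hr, Matrix.cons_val_zero,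
      Matrix.cons_val_one]
    have hPQ : D * (P v ^ 2 + P v * Q v + x * Q v ^ 2) =
        v.1 0 ^ 2 + v.1 0 * v.1 1 + x * v.1 1 ^ 2 := by
      rw [hP, hQ]
      generalize v.1 0 = p, v.1 1 = q
      have e : (l * p + x * m * q) ^ 2 + (l * p + x * m * q) * (m * p + (l + m) * q)
          + x * (m * p + (l + m) * q) ^ 2 = D * (p ^ 2 + p * q + x * q ^ 2) := by
        rw [hD]
        linear_combination ((2 * l * x * m + x * m ^ 2) * p * q
          + (x * m ^ 2 + x * l * m) * q ^ 2) * h2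
      apply mul_left_cancel₀ hD0
      rw [← e]
      field_simp
    rw [← hPQ]
    generalize P v = p, Q v = q
    have e₁ : n 3 * (N / (n 3 * (b * c))) * (b * c) = N := by field_simp
    have e₂ : b * c * (x * n 3 ^ 2 * (b * c) / N) * (N / (n 3 * (b * c))) ^ 2 = x * N := by
      field_simp
    linear_combination p * q * e₁ + q ^ 2 * e₂ - (p ^ 2 + p * q + x * q ^ 2) * h0 - p ^ 2 * hN
      + (v.2 0 * n 0 + b * v.2 1 * n 1 + c * v.2 2 * n 2) * p * h2
  refine ⟨2, ![Units.mk0 b hb, Units.mk0 c hc], x * n 3 ^ 2 * (b * c) / N, by simp, 1, f, ?_, ?_⟩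
  · rw [injective_iff_map_eq_zero]
    intro v hv
    refine h v ?_
    rw [← hf, hv, map_zero]
  · intro v
    have e : (fun i => ((![Units.mk0 b hb, Units.mk0 c hc] i : Fˣ) : F)) = ![b, c] := by
      ext i
      fin_cases i <;> rfl
    rw [e, hf, Units.val_one, one_smul]

theorem norm_of_isPfisterNeighbour {a x b c : F}
    (h : ((a • binQF 1 x).prod (diagQF ![1, b, c])).Anisotropic)
    (hp : IsPfisterNeighbour ((a • binQF 1 x).prod (diagQF ![1, b, c]))) :
    ∃ (l m : F) (n : Fin 4 → F), (l ≠ 0 ∨ m ≠ 0) ∧ a * (l ^ 2 + l * m + x * m ^ 2) =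
        n 0 ^ 2 + b * n 1 ^ 2 + c * n 2 ^ 2 + b * c * n 3 ^ 2 := by
  have h2 : (2 : F) = 0 := CharTwo.two_eq_zero
  obtain ⟨N, s, d, hN, α, f, hf, hfq⟩ := hp
  have hV : Module.finrank F ((Fin 2 → F) × (Fin 3 → F)) = 5 := by simp
  have hle := LinearMap.finrank_le_finrank_of_injective hf
  obtain rfl : N = 2 := by
    rw [hV] at hN hle
    have hW : Module.finrank F (Finset (Fin N) → Fin 2 → F) = 2 ^ N * 2 := by
      simp [Module.finrank_pi_fintype]
    rw [hW] at hle
    rcases lt_trichotomy N 2 with hN2 | hN2 | hN2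
    · have := Nat.pow_le_pow_right (n := 2) (by norm_num) (Nat.le_of_lt_succ hN2)
      omega
    · exact hN2
    · have := Nat.pow_le_pow_right (n := 2) (by norm_num) (Nat.succ_le_succ hN2)
      omega
  have hα : (α : F) ≠ 0 := α.ne_zero
  obtain ⟨π, hπ⟩ : ∃ π, π = pfisterQF 2 (fun i => (s i : F)) d := ⟨_, rfl⟩
  rw [← hπ] at hfq
  have hfq' (v) : π (f v) = α * (a * (v.1 0 ^ 2 + v.1 0 * v.1 1 + x * v.1 1 ^ 2) +
        (v.2 0 ^ 2 + b * v.2 1 ^ 2 + c * v.2 2 ^ 2)) := by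
    rw [← hfq, smul_apply, form_apply, smul_eq_mul]
  have horth (r : Fin 3 → F) (v) : polar π (f (0, r)) (f v) = 0 := by
    rw [polar, ← map_add, hfq', hfq', hfq']
    simp only [Prod.fst_add, Prod.snd_add, Pi.add_apply, Pi.zero_apply]
    linear_combination α * (r 0 * v.2 0 + b * r 1 * v.2 1 + c * r 2 * v.2 2) * h2
  let e (i : Fin 3) := f (0, Pi.single i 1)
  obtain ⟨k, hk, hk0, hk1, hk2⟩ : ∃ k, π k = π (e 0) * π (e 1) * π (e 2) ∧ polar π k (e 0) = 0 ∧
      polar π k (e 1) = 0 ∧ polar π k (e 2) = 0 := by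
    subst hπ
    exact exists_orthogonal_pfisterQF _ d (e 0) (e 1) (e 2) (horth _ _) (horth _ _) (horth _ _)
  have hk' (r : Fin 3 → F) : polar π (f (0, r)) k = 0 := by
    have hr : f (0, r) = r 0 • e 0 + r 1 • e 1 + r 2 • e 2 := by
      simp only [e, ← map_smul, ← map_add]
      congr 1
      ext i <;> simp
      fin_cases i <;> simp
    rw [hr, polar_add_left, polar_add_left, polar_smul_left, polar_smul_left, polar_smul_left,
      polar_comm _ (e 0), polar_comm _ (e 1), polar_comm _ (e 2), hk0, hk1, hk2]
    simp
  let g : (Fin 3 → F) →ₗ[F] (Finset (Fin 2) → Fin 2 → F) := f ∘ₗ LinearMap.inr F (Fin 2 → F) _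
  have hg : Function.Injective g := hf.comp LinearMap.inr_injective
  let B : LinearMap.BilinForm F (Finset (Fin 2) → Fin 2 → F) := polarBilin π
  have hB : B.Nondegenerate := by
    subst hπ
    exact polarBilin_pfisterQF_nondegenerate s d
  have hrange : LinearMap.range f = B.orthogonal (LinearMap.range g) := by
    apply Submodule.eq_of_le_of_finrank_eq
    · rintro _ ⟨v, rfl⟩ _ ⟨r, rfl⟩
      exact horth r v
    · rw [LinearMap.BilinForm.finrank_orthogonal hB, LinearMap.finrank_range_of_inj hf,
        LinearMap.finrank_range_of_inj hg]
      simp [Module.finrank_pi_fintype]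
  obtain ⟨v, rfl⟩ : k ∈ LinearMap.range f := by
    rw [hrange]
    rintro _ ⟨r, rfl⟩
    exact hk' r
  have hval : a * (v.1 0 ^ 2 + v.1 0 * v.1 1 + x * v.1 1 ^ 2) =
      v.2 0 ^ 2 + b * v.2 1 ^ 2 + c * v.2 2 ^ 2 + b * c * α ^ 2 := by
    rw [hfq', hfq', hfq', hfq'] at hk
    simp at hk
    apply mul_left_cancel₀ hα
    linear_combination hk + (-α * (v.2 0 ^ 2 + b * v.2 1 ^ 2 + c * v.2 2 ^ 2)) * h2
  refine ⟨v.1 0, v.1 1, ![v.2 0, v.2 1, v.2 2, α], ?_, by simpa using hval⟩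
  by_contra! hv
  rw [hv.1, hv.2] at hval
  have hα' := eq_zero_of_form_eq_zero h (p := 0) (q := 0) (r := v.2 0 * v.2 2 + b * v.2 1 * α)
    (s := v.2 0 * α + v.2 1 * v.2 2) (t := v.2 2 ^ 2 + b * α ^ 2) (by
      linear_combination -(v.2 2 ^ 2 + b * α ^ 2) * hval + (2 * b * v.2 0 * v.2 1 * v.2 2 * α) * h2)
  have hα'' := eq_zero_of_form_eq_zero h (p := 0) (q := 0) (r := v.2 2) (s := α) (t := 0) (by
    linear_combination hα'.2.2.2.2)
  exact hα hα''.2.2.2.1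

end Main


theorem stmt17 (F : Type) [Field F] [CharP F 2] (a x b c : Fˣ)
    (hφa : (((a : F) • binQF 1 (x : F)).prod
      (diagQF ![(1 : F), (b : F), (c : F)])).Anisotropic) :
    (IsPfisterNeighbour (((a : F) • binQF 1 (x : F)).prod
        (diagQF ![(1 : F), (b : F), (c : F)])) ↔
      QuatSplit (↥(sqrtExt F ![(b : F), (c : F)]))
        (algebraMap F (↥(sqrtExt F ![(b : F), (c : F)])) (x : F))
        (algebraMap F (↥(sqrtExt F ![(b : F), (c : F)])) (a : F))) := by
  rw [quatSplit_sqrtExt_iff a.ne_zero hφa]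
  exact ⟨norm_of_isPfisterNeighbour hφa, fun ⟨_, _, _, hlm, h⟩ =>
    isPfisterNeighbour_of_norm b.ne_zero c.ne_zero hφa hlm h⟩
end
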